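/- Let d ≥ 3 and fix κ > 0. For each integer L_0 > 1 set u_0(L_0) = κ(log L_0)²·L_0^{−(d−2)}, and let Q_{L_0} be any vacant-set law at level u_0(L_0). Let q_0(u_0(L_0)) = Q_{L_0}[there is a *-path from [−L_0, L_0]² ∩ ℤ² to ∂_int([−3L_0, 3L_0]^d ∩ ℤ^d) all of whose points lie in {x ∈ ℤ² : Y_x = 0}]. Then for every ρ > 0, L_0^ρ · q_0(u_0(L_0)) → 0 as L_0 → ∞. -/

import Mathlib

open MeasureTheory Filter

namespace RI

/-- Points of `ℤ^d`. -/
abbrev Zd (d : ℕ) := Fin d → ℤ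

/-- `x` and `y` are nearest neighbours: `|x - y| = 1`. -/
def adj {d : ℕ} (x y : Zd d) : Prop := (∑ i, |x i - y i|) = 1

/-- `x` and `y` are `*`-neighbours: `|x - y|_∞ = 1`. -/
def starAdj {d : ℕ} (x y : Zd d) : Prop := x ≠ y ∧ ∀ i, |x i - y i| ≤ 1

/-- `x` belongs to the plane `ℤ e₁ + ℤ e₂ ⊆ ℤ^d`. -/
def inPlane {d : ℕ} (x : Zd d) : Prop := ∀ i : Fin d, 2 ≤ (i : ℕ) → x i = 0

/-- The `k`-th coordinate of `x`, with value `0` for out-of-range indices. -/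
def coord {d : ℕ} (x : Zd d) (k : ℕ) : ℤ := if h : k < d then x ⟨k, h⟩ else 0

/-- `P` is the family of laws of the simple random walks on `ℤ^d` started at the points of
`ℤ^d`: each `P x` is a probability measure on the path space `ℕ → ℤ^d`, and the cylinder
probabilities are those of the walk with i.i.d. increments uniform on `{± e_i}`. -/
def IsSRW (d : ℕ) (P : Zd d → Measure (ℕ → Zd d)) : Prop :=
  (∀ x, IsProbabilityMeasure (P x)) ∧
  (∀ (x : Zd d) (n : ℕ) (w : ℕ → Zd d),
      (w 0 = x ∧ ∀ k < n, adj (w k) (w (k + 1))) →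
        P x {ω | ∀ k ≤ n, ω k = w k} = ((2 * d : ENNReal))⁻¹ ^ n) ∧
  (∀ (x : Zd d) (n : ℕ) (w : ℕ → Zd d),
      ¬(w 0 = x ∧ ∀ k < n, adj (w k) (w (k + 1))) →
        P x {ω | ∀ k ≤ n, ω k = w k} = 0)

/-- The equilibrium measure of a set `V ⊆ ℤ^d`:
`e_V(x) = P_x[H̃_V = ∞]` for `x ∈ V`, and `0` otherwise. -/
noncomputable def eqm {d : ℕ} (P : Zd d → Measure (ℕ → Zd d)) (V : Set (Zd d)) : Zd d → ℝ :=
  V.indicator fun x => (P x {ω | ∀ n, 1 ≤ n → ω n ∉ V}).toReal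

/-- The capacity of a finite set `K ⊆ ℤ^d`. -/
noncomputable def capa {d : ℕ} (P : Zd d → Measure (ℕ → Zd d)) (K : Finset (Zd d)) : ℝ :=
  ∑ x ∈ K, eqm P (↑K) x

/-- `Q` is a vacant-set law at level `u`: a probability measure on `{0,1}^{ℤ^d}`
(with `true = 1` standing for "vacant") such that
`Q[Y_x = 1 ∀ x ∈ K] = exp(-u cap K)` for every finite `K`. -/
def IsVacantLaw {d : ℕ} (P : Zd d → Measure (ℕ → Zd d)) (u : ℝ)
    (Q : Measure (Zd d → Bool)) : Prop :=
  IsProbabilityMeasure Q ∧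
  ∀ K : Finset (Zd d),
    Q {Y | ∀ x ∈ K, Y x = true} = ENNReal.ofReal (Real.exp (-(u * capa P K)))

/-- There is a `*`-path starting in `S`, ending in `T`, all of whose points lie in `A`. -/
def HasStarPath {d : ℕ} (S T A : Set (Zd d)) : Prop :=
  ∃ (N : ℕ) (w : ℕ → Zd d), w 0 ∈ S ∧ w N ∈ T ∧ (∀ k ≤ N, w k ∈ A) ∧
    ∀ k < N, starAdj (w k) (w (k + 1))

/-- Interior boundary `∂_int U`. -/
def intBdry {d : ℕ} (U : Set (Zd d)) : Set (Zd d) := {x | x ∈ U ∧ ∃ y, y ∉ U ∧ adj x y}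

/-- (Exterior) boundary `∂U`. -/
def bdry {d : ℕ} (U : Set (Zd d)) : Set (Zd d) := {x | x ∉ U ∧ ∃ y ∈ U, adj x y}

/-- `ℓ = 100 ⌊L^{1/100}⌋ + 1`. -/
noncomputable def ellOf (L : ℕ) : ℕ := 100 * ⌊(L : ℝ) ^ ((1 : ℝ) / 100)⌋₊ + 1

/-- The scales `L_{n+1} = ℓ_n L_n`. -/
noncomputable def Lseq (L0 : ℕ) : ℕ → ℕ
  | 0 => L0
  | n + 1 => ellOf (Lseq L0 n) * Lseq L0 n

/-- The levels `u_{n+1} = (1 + 1/log L_n)⁻¹ u_n`. -/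
noncomputable def useq (L0 : ℕ) (u0 : ℝ) : ℕ → ℝ
  | 0 => u0
  | n + 1 => (1 + 1 / Real.log (Lseq L0 n))⁻¹ * useq L0 u0 n

/-- The event (on the configuration space `{0,1}^{ℤ^d}`) that there is a `*`-path from
`[-L,L]² ∩ ℤ²` to `∂_int ([-3L,3L]^d ∩ ℤ^d)` all of whose points lie in `{x ∈ ℤ² : Y_x = 0}`. -/
def qEvent (d : ℕ) (L : ℕ) : Set (Zd d → Bool) :=
  {Y | HasStarPath
    {x : Zd d | inPlane x ∧ ∀ i, |x i| ≤ (L : ℤ)}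
    (intBdry {x : Zd d | ∀ i, |x i| ≤ (3 * L : ℤ)})
    {x : Zd d | inPlane x ∧ Y x = false}}


end RI

namespace RI

/-- The `i`-th unit vector of `ℤ^d`. -/
def unitVec {d : ℕ} (i : Fin d) : Zd d := Pi.single i 1

/-- The transition operator of simple random walk: the average of `f` over the neighbours. -/
noncomputable def avg (d : ℕ) : Module.End ℝ (Zd d → ℝ) where
  toFun f x := (2 * d : ℝ)⁻¹ * ∑ i, (f (x + unitVec i) + f (x - unitVec i))
  map_add' f g := by
    ext x
    simp only [Pi.add_apply, ← mul_add, ← Finset.sum_add_distrib]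
    congr 1
    exact Finset.sum_congr rfl fun i _ => by ring
  map_smul' c f := by
    ext x
    simp only [Pi.smul_apply, smul_eq_mul, RingHom.id_apply, ← mul_add, ← Finset.mul_sum]
    ring

theorem avg_apply {d : ℕ} (f : Zd d → ℝ) (x : Zd d) :
    avg d f x = (2 * d : ℝ)⁻¹ * ∑ i, (f (x + unitVec i) + f (x - unitVec i)) := rfl

theorem avg_pow_succ {d : ℕ} (n : ℕ) (f : Zd d → ℝ) :
    (avg d ^ (n + 1)) f = avg d ((avg d ^ n) f) := by
  rw [pow_succ', Module.End.mul_apply]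

theorem avg_pow_add {d : ℕ} (m n : ℕ) (f : Zd d → ℝ) :
    (avg d ^ (m + n)) f = (avg d ^ m) ((avg d ^ n) f) := by
  rw [pow_add, Module.End.mul_apply]

theorem avg_mono {d : ℕ} {f g : Zd d → ℝ} (h : f ≤ g) : avg d f ≤ avg d g := by
  intro x
  rw [avg_apply, avg_apply]
  refine mul_le_mul_of_nonneg_left ?_ (by positivity)
  exact Finset.sum_le_sum fun i _ => add_le_add (h _) (h _)

theorem avg_pow_mono {d : ℕ} (n : ℕ) {f g : Zd d → ℝ} (h : f ≤ g) :
    (avg d ^ n) f ≤ (avg d ^ n) g := by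
  induction n with
  | zero => simpa using h
  | succ n ih => rw [avg_pow_succ, avg_pow_succ]; exact avg_mono ih

theorem avg_const {d : ℕ} (hd : 0 < d) (c : ℝ) : avg d (fun _ => c) = fun _ => c := by
  ext x
  have : (d : ℝ) ≠ 0 := by positivity
  rw [avg_apply]
  simp
  field_simp
  ring

theorem avg_pow_const {d : ℕ} (hd : 0 < d) (n : ℕ) (c : ℝ) :
    (avg d ^ n) (fun _ => c) = fun _ => c := by
  induction n with
  | zero => rfl
  | succ n ih => rw [avg_pow_succ, ih, avg_const hd]

theorem avg_pow_nonneg {d : ℕ} (n : ℕ) {f : Zd d → ℝ} (h : 0 ≤ f) : 0 ≤ (avg d ^ n) f := by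
  simpa using avg_pow_mono n h

theorem avg_pow_translate {d : ℕ} (n : ℕ) (f : Zd d → ℝ) (a x : Zd d) :
    (avg d ^ n) (fun y => f (y + a)) x = (avg d ^ n) f (x + a) := by
  induction n generalizing x with
  | zero => rfl
  | succ n ih =>
    rw [avg_pow_succ, avg_pow_succ, avg_apply, avg_apply]
    simp only [ih]
    congr 1
    refine Finset.sum_congr rfl fun i _ => ?_
    rw [show x + unitVec i + a = x + a + unitVec i by abel,
      show x - unitVec i + a = x + a - unitVec i by abel]

theorem avg_pow_reflect {d : ℕ} (n : ℕ) (f : Zd d → ℝ) (x : Zd d) :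
    (avg d ^ n) (fun y => f (-y)) x = (avg d ^ n) f (-x) := by
  induction n generalizing x with
  | zero => rfl
  | succ n ih =>
    rw [avg_pow_succ, avg_pow_succ, avg_apply, avg_apply]
    simp only [ih]
    congr 1
    refine Finset.sum_congr rfl fun i _ => ?_
    rw [show -(x + unitVec i) = -x - unitVec i by abel,
      show -(x - unitVec i) = -x + unitVec i by abel, add_comm]

theorem avg_pow_swap {d : ℕ} (m n : ℕ) (F : Zd d → Zd d → ℝ) (x z : Zd d) :
    (avg d ^ m) (fun y => (avg d ^ n) (F y) z) x =
      (avg d ^ n) (fun w => (avg d ^ m) (fun y => F y w) x) z := by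
  induction m generalizing x with
  | zero => rfl
  | succ m ih =>
    have : (fun w => (avg d ^ (m + 1)) (fun y => F y w) x) =
        (2 * d : ℝ)⁻¹ • ∑ i, ((fun w => (avg d ^ m) (fun y => F y w) (x + unitVec i)) +
          fun w => (avg d ^ m) (fun y => F y w) (x - unitVec i)) := by
      ext w
      simp [avg_pow_succ, avg_apply]
    rw [this, avg_pow_succ, avg_apply, map_smul, map_sum]
    simp [ih]

/-- The squared Euclidean norm. -/
def nsq {d : ℕ} (x : Zd d) : ℝ := ∑ i, (x i : ℝ) ^ 2

theorem nsq_nonneg {d : ℕ} (x : Zd d) : 0 ≤ nsq x := Finset.sum_nonneg fun _ _ => sq_nonneg _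

theorem nsq_add_unitVec {d : ℕ} (x : Zd d) (i : Fin d) :
    nsq (x + unitVec i) = nsq x + 2 * x i + 1 := by
  have : ∀ j, ((x + unitVec i) j : ℝ) ^ 2 = (x j : ℝ) ^ 2 + (if j = i then 2 * (x i : ℝ) + 1 else 0) := by
    intro j
    by_cases h : j = i
    · subst h; simp [unitVec]; ring
    · simp [unitVec, h]
  simp only [nsq, this, Finset.sum_add_distrib]
  simp
  ring

theorem nsq_sub_unitVec {d : ℕ} (x : Zd d) (i : Fin d) :
    nsq (x - unitVec i) = nsq x - 2 * x i + 1 := by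
  have := nsq_add_unitVec (x - unitVec i) i
  simp only [sub_add_cancel] at this
  have h2 : ((x - unitVec i) i : ℝ) = x i - 1 := by simp [unitVec]
  rw [h2] at this
  linarith

theorem avg_pow_nsq {d : ℕ} (hd : 0 < d) (n : ℕ) (x : Zd d) :
    (avg d ^ n) nsq x = nsq x + n := by
  induction n generalizing x with
  | zero => simp
  | succ n ih =>
    have : (d : ℝ) ≠ 0 := by positivity
    rw [avg_pow_succ, avg_apply]
    simp only [ih, nsq_add_unitVec, nsq_sub_unitVec]
    rw [Finset.sum_congr rfl fun i _ => show nsq x + 2 * (x i : ℝ) + 1 + n +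
      (nsq x - 2 * x i + 1 + n) = 2 * (nsq x + (n + 1)) by ring]
    simp
    field_simp

/-- The heat kernel: the probability that the walk started at `x` is at the origin at time `n`. -/
noncomputable def heat {d : ℕ} (n : ℕ) (x : Zd d) : ℝ := (avg d ^ n) (Pi.single 0 1) x

theorem heat_nonneg {d : ℕ} (n : ℕ) (x : Zd d) : 0 ≤ heat n x := by
  refine avg_pow_nonneg n ?_ x
  intro y
  by_cases h : y = 0
  · subst h; simp
  · simp [h]

theorem heat_neg {d : ℕ} (n : ℕ) (x : Zd d) : heat n (-x) = heat n x := by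
  rw [heat, ← avg_pow_reflect, heat]
  refine congrFun (congrArg _ (funext fun y => ?_)) _
  by_cases h : y = 0
  · subst h; simp
  · simp [h]

theorem avg_pow_single {d : ℕ} (n : ℕ) (x y : Zd d) :
    (avg d ^ n) (fun z => if z = y then 1 else 0) x = heat n (x - y) := by
  rw [heat, sub_eq_add_neg, ← avg_pow_translate]
  refine congrFun (congrArg _ (funext fun z => ?_)) _
  simp [Pi.single_apply, add_neg_eq_zero]

theorem heat_add {d : ℕ} (m n : ℕ) (x : Zd d) : heat (m + n) x = (avg d ^ m) (heat n) x := by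
  rw [heat, avg_pow_add]; rfl

/-- The product form of the second-moment bound for the heat kernel. -/
theorem nsq_mul_heat_add_le {d : ℕ} (hd : 0 < d) (m n : ℕ) {a b : ℝ}
    (ha : ∀ x : Zd d, heat m x ≤ a) (hb : ∀ x : Zd d, heat n x ≤ b) (x : Zd d) :
    nsq x * heat (m + n) x ≤ 2 * (m * b + n * a) := by
  have h1 : (avg d ^ m) (fun y => nsq (y - x) * heat n y) x ≤ m * b := by
    calc _ ≤ (avg d ^ m) (b • fun y => nsq (y + -x)) x := by
          refine avg_pow_mono m (fun y => ?_) x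
          simp only [Pi.smul_apply, smul_eq_mul, ← sub_eq_add_neg]
          rw [mul_comm]
          exact mul_le_mul_of_nonneg_right (hb y) (nsq_nonneg _)
      _ = m * b := by
          rw [map_smul, Pi.smul_apply, avg_pow_translate, avg_pow_nsq hd]
          simp [nsq, mul_comm]
  have h2 : (avg d ^ m) (fun y => nsq y * heat n y) x ≤ n * a := by
    have e : ∀ y : Zd d, nsq y * heat n y =
        (avg d ^ n) (fun z => nsq z * if y = z then 1 else 0) 0 := by
      intro y
      have : (fun z => nsq z * if y = z then (1 : ℝ) else 0) =
          nsq y • fun z => if z = y then (1 : ℝ) else 0 := by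
        ext z
        by_cases h : z = y
        · subst h; simp
        · simp [h, Ne.symm h]
      rw [this, map_smul, Pi.smul_apply, avg_pow_single, zero_sub, heat_neg, smul_eq_mul]
    simp only [e]
    rw [avg_pow_swap]
    calc _ ≤ (avg d ^ n) (a • nsq) 0 := by
          refine avg_pow_mono n (fun z => ?_) 0
          have : (fun y => nsq z * if y = z then (1 : ℝ) else 0) =
            nsq z • fun y => if y = z then (1 : ℝ) else 0 := rfl
          simp only [this, map_smul, Pi.smul_apply, avg_pow_single, smul_eq_mul]
          rw [mul_comm]
          exact mul_le_mul_of_nonneg_right (ha _) (nsq_nonneg _)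
      _ = n * a := by
          rw [map_smul, Pi.smul_apply, avg_pow_nsq hd]
          simp [nsq, mul_comm]
  have h3 : nsq x * heat (m + n) x ≤ (avg d ^ m) ((2 : ℝ) • (fun y => nsq (y - x) * heat n y) +
      (2 : ℝ) • fun y => nsq y * heat n y) x := by
    rw [heat_add]
    change (nsq x • (avg d ^ m) (heat n)) x ≤ _
    rw [← map_smul]
    refine avg_pow_mono m (fun y => ?_) x
    simp only [Pi.smul_apply, Pi.add_apply, smul_eq_mul]
    have : nsq x ≤ 2 * nsq (y - x) + 2 * nsq y := by
      simp only [nsq, Finset.mul_sum, ← Finset.sum_add_distrib]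
      refine Finset.sum_le_sum fun i _ => ?_
      simp only [Pi.sub_apply, Int.cast_sub]
      nlinarith [sq_nonneg (2 * (y i : ℝ) - x i)]
    calc _ ≤ (2 * nsq (y - x) + 2 * nsq y) * heat n y :=
          mul_le_mul_of_nonneg_right this (heat_nonneg _ _)
      _ = _ := by ring
  rw [map_add, map_smul, map_smul] at h3
  simp only [Pi.smul_apply, Pi.add_apply, smul_eq_mul] at h3
  linarith

/-- Lebesgue measure on the cube `(-π, π]^d`. -/
noncomputable def cube (d : ℕ) : Measure (Fin d → ℝ) :=
  Measure.pi fun _ => volume.restrict (Set.Ioc (-Real.pi) Real.pi)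

noncomputable instance (d : ℕ) : IsFiniteMeasure (cube d) := by
  unfold cube; infer_instance

/-- The characteristic function of a step of the walk. -/
noncomputable def charFn {d : ℕ} (θ : Fin d → ℝ) : ℝ := (d : ℝ)⁻¹ * ∑ i, Real.cos (θ i)

theorem integral_cos_cube {d : ℕ} (x : Zd d) :
    ∫ θ, Real.cos (∑ i, θ i * x i) ∂(cube d) = (2 * Real.pi) ^ d * (Pi.single 0 1 : Zd d → ℝ) x := by
  have h1 : ∀ θ : Fin d → ℝ, Real.cos (∑ i, θ i * x i) =
      (∏ i, Complex.exp ((x i : ℂ) * Complex.I * (θ i : ℝ))).re := by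
    intro θ
    rw [← Complex.exp_sum, ← Complex.exp_ofReal_mul_I_re]
    congr 2
    push_cast
    rw [Finset.sum_mul]
    exact Finset.sum_congr rfl fun i _ => by ring
  have h2 : ∀ k : ℤ, ∫ t in Set.Ioc (-Real.pi) Real.pi, Complex.exp ((k : ℂ) * Complex.I * (t : ℝ)) =
      if k = 0 then ((2 * Real.pi : ℝ) : ℂ) else 0 := by
    intro k
    rw [← intervalIntegral.integral_of_le (by linarith [Real.pi_pos])]
    split_ifs with h
    · subst h
      simp
      ring
    · have hk : (k : ℂ) * Complex.I ≠ 0 := by simp [h]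
      rw [integral_exp_mul_complex hk]
      have : Complex.exp ((k : ℂ) * Complex.I * (Real.pi : ℝ)) =
          Complex.exp ((k : ℂ) * Complex.I * ((-Real.pi : ℝ) : ℂ)) := by
        rw [Complex.exp_eq_exp_iff_exists_int]
        exact ⟨k, by push_cast; ring⟩
      rw [this, sub_self, zero_div]
  simp only [h1]
  have hint : Integrable (fun θ : Fin d → ℝ => ∏ i, Complex.exp ((x i : ℂ) * Complex.I * (θ i : ℝ)))
      (cube d) := by
    refine Integrable.of_bound (C := 1) ?_ ?_
    · exact (by fun_prop : Continuous _).aestronglyMeasurable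
    · refine ae_of_all _ fun θ => ?_
      rw [norm_prod]
      refine Finset.prod_le_one (fun _ _ => norm_nonneg _) fun i _ => ?_
      rw [show (x i : ℂ) * Complex.I * (θ i : ℝ) = ((x i * θ i : ℝ) : ℂ) * Complex.I by
        push_cast; ring, Complex.norm_exp_ofReal_mul_I]
  have h3 := integral_re (𝕜 := ℂ) hint
  simp only [RCLike.re_to_complex] at h3
  rw [h3, cube, integral_fintype_prod_eq_prod (fun i (t : ℝ) =>
    Complex.exp ((x i : ℂ) * Complex.I * (t : ℝ)))]
  simp only [h2]
  by_cases hx : x = 0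
  · subst hx
    have : (2 * (Real.pi : ℂ)) ^ d = (((2 * Real.pi) ^ d : ℝ) : ℂ) := by push_cast; rfl
    simp
    rw [this, Complex.ofReal_re]
  · obtain ⟨i, hi⟩ := Function.ne_iff.mp hx
    rw [Finset.prod_eq_zero (Finset.mem_univ i) (by simpa using hi)]
    simp [hx]

theorem integrable_charFn_pow_mul_cos {d : ℕ} (n : ℕ) (y : Zd d) : Integrable
    (fun θ : Fin d → ℝ => charFn θ ^ n * Real.cos (∑ i, θ i * y i)) (cube d) := by
  refine Integrable.of_bound (C := 1) ?_ ?_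
  · unfold charFn
    exact (by fun_prop : Continuous _).aestronglyMeasurable
  · refine ae_of_all _ fun θ => ?_
    rw [Real.norm_eq_abs, abs_mul, abs_pow]
    have : |charFn θ| ≤ 1 := by
      rw [charFn, abs_mul, abs_of_nonneg (by positivity)]
      refine inv_mul_le_of_le_mul₀ (by positivity) (by norm_num) ?_
      refine (Finset.abs_sum_le_sum_abs _ _).trans ?_
      refine (Finset.sum_le_sum fun i _ => Real.abs_cos_le_one _).trans ?_
      simp
    exact mul_le_one₀ (pow_le_one₀ (abs_nonneg _) this) (abs_nonneg _) (Real.abs_cos_le_one _)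

theorem heat_eq_integral {d : ℕ} (hd : 0 < d) (n : ℕ) (x : Zd d) :
    (2 * Real.pi) ^ d * heat n x =
      ∫ θ, charFn θ ^ n * Real.cos (∑ i, θ i * x i) ∂(cube d) := by
  have hd' : (d : ℝ) ≠ 0 := by positivity
  induction n generalizing x with
  | zero => simp [integral_cos_cube, heat]
  | succ n ih =>
    have hs : ∀ (y : Zd d) (i : Fin d) (θ : Fin d → ℝ),
        ∑ j, θ j * ((y + unitVec i) j : ℝ) = ∑ j, θ j * (y j : ℝ) + θ i := by
      intro y i θ
      simp [unitVec, mul_add, Finset.sum_add_distrib, Pi.single_apply]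
    have hs' : ∀ (y : Zd d) (i : Fin d) (θ : Fin d → ℝ),
        ∑ j, θ j * ((y - unitVec i) j : ℝ) = ∑ j, θ j * (y j : ℝ) - θ i := by
      intro y i θ
      simp [unitVec, mul_sub, Finset.sum_sub_distrib, Pi.single_apply]
    have e1 : heat (n + 1) x = avg d (heat n) x := by rw [heat, avg_pow_succ]; rfl
    rw [e1, avg_apply, mul_left_comm, Finset.mul_sum]
    simp only [mul_add, ih]
    have hint := integrable_charFn_pow_mul_cos (d := d) n
    rw [Finset.sum_congr rfl fun i _ => (integral_add (hint (x + unitVec i))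
      (hint (x - unitVec i))).symm, ← integral_finsetSum Finset.univ fun i _ => by
      exact (hint (x + unitVec i)).add (hint (x - unitVec i)), ← integral_const_mul]
    congr 1
    ext θ
    simp only [hs, hs', Real.cos_add, Real.cos_sub]
    rw [Finset.sum_congr rfl fun i _ => show _ = (2 * charFn θ ^ n *
      Real.cos (∑ j, θ j * (x j : ℝ))) * Real.cos (θ i) by ring, ← Finset.mul_sum, pow_succ]
    have hc : ∑ i, Real.cos (θ i) = d * charFn θ := by
      rw [charFn]
      field_simp
    rw [hc]
    field_simp

theorem integral_exp_neg_mul_sin_sq_le {a : ℝ} (ha : 0 < a) :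
    ∫ t in Set.Ioc (-Real.pi) Real.pi, Real.exp (-a * Real.sin t ^ 2) ≤ 9 / Real.sqrt a := by
  have hpi := Real.pi_pos
  set b : ℝ := a * (2 / Real.pi) ^ 2 with hb
  have hb0 : 0 < b := by positivity
  have hg : Integrable (fun t : ℝ => Real.exp (-b * t ^ 2)) := integrable_exp_neg_mul_sq hb0
  have hg1 := hg.comp_sub_right Real.pi
  have hg2 := hg.comp_add_right Real.pi
  have key : ∀ s : ℝ, |s| ≤ Real.pi / 2 → Real.exp (-a * Real.sin s ^ 2) ≤ Real.exp (-b * s ^ 2) := by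
    intro s hs
    have h1 := Real.mul_abs_le_abs_sin hs
    rw [Real.exp_le_exp, hb]
    have h2 : (2 / Real.pi * |s|) ^ 2 ≤ Real.sin s ^ 2 := by
      rw [← sq_abs (Real.sin s)]
      exact pow_le_pow_left₀ (by positivity) h1 2
    rw [mul_pow, sq_abs] at h2
    nlinarith
  calc _ ≤ ∫ t in Set.Ioc (-Real.pi) Real.pi, (Real.exp (-b * t ^ 2) +
        Real.exp (-b * (t - Real.pi) ^ 2) + Real.exp (-b * (t + Real.pi) ^ 2)) := by
        refine setIntegral_mono_on ?_ ((hg.add hg1).add hg2).integrableOn measurableSet_Ioc ?_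
        · exact (by fun_prop : Continuous fun t : ℝ => Real.exp (-a * Real.sin t ^ 2)).integrableOn_Ioc
        · intro t ht
          have p1 := (Real.exp_pos (-b * t ^ 2)).le
          have p2 := (Real.exp_pos (-b * (t - Real.pi) ^ 2)).le
          have p3 := (Real.exp_pos (-b * (t + Real.pi) ^ 2)).le
          rcases le_total t (-(Real.pi / 2)) with h | h
          · have := key (t + Real.pi) (by rw [abs_le]; constructor <;> linarith [ht.1, ht.2])
            rw [Real.sin_add_pi, neg_sq] at this
            linarith
          · rcases le_total t (Real.pi / 2) with h' | h'
            · have := key t (by rw [abs_le]; constructor <;> linarith [ht.1, ht.2])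
              linarith
            · have := key (t - Real.pi) (by rw [abs_le]; constructor <;> linarith [ht.1, ht.2])
              rw [Real.sin_sub_pi, neg_sq] at this
              linarith
    _ ≤ ∫ t, (Real.exp (-b * t ^ 2) +
        Real.exp (-b * (t - Real.pi) ^ 2) + Real.exp (-b * (t + Real.pi) ^ 2)) :=
        setIntegral_le_integral ((hg.add hg1).add hg2) (ae_of_all _ fun t => by
          simp only [Pi.zero_apply]; positivity)
    _ = 3 * Real.sqrt (Real.pi / b) := by
        rw [integral_add (by exact hg.add hg1) hg2, integral_add hg hg1,
          integral_sub_right_eq_self (fun t => Real.exp (-b * t ^ 2)),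
          integral_add_right_eq_self (fun t => Real.exp (-b * t ^ 2)), integral_gaussian]
        ring
    _ ≤ _ := by
        rw [show (9 : ℝ) / Real.sqrt a = 3 * (3 / Real.sqrt a) by ring]
        refine mul_le_mul_of_nonneg_left ?_ (by norm_num)
        rw [Real.sqrt_le_left (by positivity), div_pow, Real.sq_sqrt ha.le, hb]
        rw [div_le_div_iff₀ (by positivity) ha]
        have h3 : Real.pi ≤ 3.15 := Real.pi_lt_d2.le
        have h4 : Real.pi * Real.pi ^ 2 ≤ 36 := by nlinarith
        have : 3 ^ 2 * (a * (2 / Real.pi) ^ 2) = 36 * a / Real.pi ^ 2 := by field_simp; norm_num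
        rw [this, le_div_iff₀ (by positivity)]
        nlinarith

theorem heat_two_mul_le {d : ℕ} (hd : 0 < d) {n : ℕ} (hn : 0 < n) (x : Zd d) :
    heat (2 * n) x ≤ (9 * Real.sqrt d / Real.sqrt n) ^ d := by
  have hd' : (0 : ℝ) < d := by positivity
  have hn' : (0 : ℝ) < n := by positivity
  have hpi := Real.pi_gt_three
  have e := heat_eq_integral hd (2 * n) x
  have hb : ∀ θ : Fin d → ℝ, charFn θ ^ (2 * n) * Real.cos (∑ i, θ i * x i) ≤
      ∏ i, Real.exp (-(n / d : ℝ) * Real.sin (θ i) ^ 2) := by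
    intro θ
    have h1 : charFn θ ^ 2 ≤ Real.exp (-(d : ℝ)⁻¹ * ∑ i, Real.sin (θ i) ^ 2) := by
      have h3 := sq_sum_le_card_mul_sum_sq (s := Finset.univ) (f := fun i => Real.cos (θ i))
      simp only [Finset.card_univ, Fintype.card_fin] at h3
      have h4 : ∑ i, Real.cos (θ i) ^ 2 = d - ∑ i, Real.sin (θ i) ^ 2 := by
        simp [Real.cos_sq', Finset.sum_sub_distrib]
      rw [h4] at h3
      refine le_trans ?_ (Real.add_one_le_exp _)
      rw [charFn, mul_pow]
      calc _ ≤ (d : ℝ)⁻¹ ^ 2 * (d * (d - ∑ i, Real.sin (θ i) ^ 2)) :=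
            mul_le_mul_of_nonneg_left h3 (by positivity)
        _ = _ := by field_simp; ring
    calc _ ≤ charFn θ ^ (2 * n) * 1 := by
          refine mul_le_mul_of_nonneg_left (Real.cos_le_one _) ?_
          rw [pow_mul]; positivity
      _ ≤ Real.exp (-(d : ℝ)⁻¹ * ∑ i, Real.sin (θ i) ^ 2) ^ n := by
          rw [mul_one, pow_mul]
          exact pow_le_pow_left₀ (sq_nonneg _) h1 n
      _ = _ := by
          rw [← Real.exp_nat_mul, ← Real.exp_sum, ← Finset.mul_sum]
          congr 1
          ring
  have hi : Integrable (fun θ : Fin d → ℝ => ∏ i, Real.exp (-(n / d : ℝ) * Real.sin (θ i) ^ 2))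
      (cube d) := by
    refine Integrable.of_bound (C := 1) ?_ ?_
    · exact (by fun_prop : Continuous _).aestronglyMeasurable
    · refine ae_of_all _ fun θ => ?_
      rw [norm_prod]
      refine Finset.prod_le_one (fun _ _ => norm_nonneg _) fun i _ => ?_
      rw [Real.norm_eq_abs, Real.abs_exp, Real.exp_le_one_iff, neg_mul]
      exact neg_nonpos.mpr (by positivity)
  have hi' := integrable_charFn_pow_mul_cos (2 * n) x
  have h5 : (2 * Real.pi) ^ d * heat (2 * n) x ≤ (9 * Real.sqrt d / Real.sqrt n) ^ d := by
    rw [e]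
    refine (integral_mono hi' hi hb).trans ?_
    rw [cube, integral_fintype_prod_eq_prod (fun _ (t : ℝ) =>
      Real.exp (-(n / d : ℝ) * Real.sin t ^ 2)), Finset.prod_const, Finset.card_univ,
      Fintype.card_fin]
    refine pow_le_pow_left₀ (integral_nonneg fun t => (Real.exp_pos _).le) ?_ d
    refine (integral_exp_neg_mul_sin_sq_le (by positivity)).trans (le_of_eq ?_)
    rw [Real.sqrt_div hn'.le]
    field_simp
  refine le_trans ?_ h5
  refine le_mul_of_one_le_left (heat_nonneg _ _) (one_le_pow₀ (by linarith))

theorem heat_succ {d : ℕ} (n : ℕ) (x : Zd d) : heat (n + 1) x = avg d (heat n) x := by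
  rw [heat, avg_pow_succ]; rfl

theorem heat_succ_le {d : ℕ} (hd : 0 < d) (n : ℕ) {c : ℝ} (h : ∀ x : Zd d, heat n x ≤ c) (x : Zd d) :
    heat (n + 1) x ≤ c := by
  rw [heat_succ]
  calc _ ≤ avg d (fun _ => c) x := avg_mono h x
    _ = c := by rw [avg_const hd]

theorem heat_le_one {d : ℕ} (hd : 0 < d) (n : ℕ) (x : Zd d) : heat n x ≤ 1 := by
  induction n generalizing x with
  | zero =>
    by_cases h : x = 0
    · subst h; simp [heat]
    · simp [heat, h]
  | succ n ih => exact heat_succ_le hd n ih x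

theorem exists_heat_le {d : ℕ} (hd : 0 < d) :
    ∃ C : ℝ, 0 < C ∧ ∀ (n : ℕ) (x : Zd d), heat n x ≤ C / Real.sqrt (n + 1) ^ d := by
  have hd' : (1 : ℝ) ≤ Real.sqrt d := by
    rw [Real.one_le_sqrt]; exact_mod_cast hd
  refine ⟨(18 * Real.sqrt d) ^ d, by positivity, fun n x => ?_⟩
  rw [← div_pow]
  rcases Nat.lt_or_ge n 2 with hn | hn
  · refine (heat_le_one hd n x).trans (one_le_pow₀ ?_)
    rw [one_le_div (by positivity)]
    have : Real.sqrt (n + 1) ≤ 2 := by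
      rw [Real.sqrt_le_left (by norm_num)]
      have : (n : ℝ) < 2 := by exact_mod_cast hn
      linarith
    linarith
  · have hm : 0 < n / 2 := by omega
    have h1 : heat n x ≤ (9 * Real.sqrt d / Real.sqrt ((n / 2 : ℕ) : ℝ)) ^ d := by
      rcases Nat.even_or_odd' n with ⟨m, rfl | rfl⟩
      · rw [Nat.mul_div_cancel_left _ (by norm_num)]
        exact heat_two_mul_le hd (by omega) x
      · rw [show (2 * m + 1) / 2 = m by omega]
        exact heat_succ_le hd _ (heat_two_mul_le hd (by omega)) x
    refine h1.trans (pow_le_pow_left₀ (by positivity) ?_ d)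
    have h2 : Real.sqrt (n + 1) ≤ 2 * Real.sqrt ((n / 2 : ℕ) : ℝ) := by
      rw [Real.sqrt_le_left (by positivity), mul_pow, Real.sq_sqrt (by positivity)]
      have : n + 1 ≤ 4 * (n / 2) := by omega
      norm_num
      exact_mod_cast this
    have h3 : 0 < Real.sqrt ((n / 2 : ℕ) : ℝ) := Real.sqrt_pos.mpr (by exact_mod_cast hm)
    rw [div_le_div_iff₀ h3 (by positivity)]
    nlinarith [mul_le_mul_of_nonneg_left h2 (by positivity : 0 ≤ 9 * Real.sqrt d)]

theorem exists_nsq_mul_heat_le {d : ℕ} (hd : 0 < d) :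
    ∃ C : ℝ, 0 < C ∧ (∀ (n : ℕ) (x : Zd d), heat n x ≤ C / Real.sqrt (n + 1) ^ d) ∧
      ∀ (n : ℕ) (x : Zd d), nsq x * heat n x ≤ C * (n + 1) / Real.sqrt (n + 1) ^ d := by
  obtain ⟨C, hC, h⟩ := exists_heat_le hd
  have hp : (1 : ℝ) ≤ 2 * 2 ^ d := by
    have : (1 : ℝ) ≤ 2 ^ d := one_le_pow₀ (by norm_num)
    linarith
  refine ⟨C * (2 * 2 ^ d), by positivity, fun n x => (h n x).trans ?_, fun n x => ?_⟩
  · gcongr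
    exact le_mul_of_one_le_right hC.le hp
  · have key : ∀ k : ℕ, n ≤ 2 * k + 1 → ∀ y : Zd d, heat k y ≤ C * 2 ^ d / Real.sqrt (n + 1) ^ d := by
      intro k hk y
      refine (h k y).trans ?_
      rw [mul_div_assoc, div_eq_mul_inv, ← div_pow, ← inv_pow]
      refine mul_le_mul_of_nonneg_left (pow_le_pow_left₀ (by positivity) ?_ d) hC.le
      have h2 : Real.sqrt (n + 1) ≤ 2 * Real.sqrt (k + 1) := by
        rw [Real.sqrt_le_left (by positivity), mul_pow, Real.sq_sqrt (by positivity)]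
        have : (n : ℝ) ≤ 2 * k + 1 := by exact_mod_cast hk
        linarith
      rw [inv_eq_one_div, div_le_div_iff₀ (by positivity) (by positivity)]
      linarith
    have := nsq_mul_heat_add_le hd (n / 2) (n - n / 2) (key (n / 2) (by omega))
      (key (n - n / 2) (by omega)) x
    rw [show n / 2 + (n - n / 2) = n by omega, ← add_mul, ← Nat.cast_add,
      show n / 2 + (n - n / 2) = n by omega] at this
    refine this.trans ?_
    rw [show 2 * ((n : ℝ) * (C * 2 ^ d / Real.sqrt (n + 1) ^ d)) =
      C * (2 * 2 ^ d) * n / Real.sqrt (n + 1) ^ d by ring]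
    gcongr
    linarith

theorem summable_heat {d : ℕ} (hd : 3 ≤ d) (x : Zd d) : Summable fun n => heat n x := by
  obtain ⟨C, hC, h⟩ := exists_heat_le (d := d) (by omega)
  refine Summable.of_nonneg_of_le (fun n => heat_nonneg n x)
    (f := fun n : ℕ => C * (1 / ((n + 1 : ℕ) : ℝ) ^ (3 / 2 : ℝ))) (fun n => ?_) ?_
  · refine (h n x).trans ?_
    rw [div_eq_mul_one_div]
    refine mul_le_mul_of_nonneg_left ?_ hC.le
    refine one_div_le_one_div_of_le (by positivity) ?_
    calc (((n + 1 : ℕ) : ℝ)) ^ (3 / 2 : ℝ) = Real.sqrt (n + 1) ^ 3 := by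
          rw [Real.sqrt_eq_rpow, ← Real.rpow_natCast, ← Real.rpow_mul (by positivity)]
          push_cast
          norm_num
      _ ≤ _ := pow_le_pow_right₀ (by rw [Real.one_le_sqrt]; linarith [n.cast_nonneg (α := ℝ)]) hd
  · exact Summable.mul_left _ ((summable_nat_add_iff 1).mpr
      (Real.summable_one_div_nat_rpow.mpr (by norm_num)))

/-- Green's function of simple random walk. -/
noncomputable def green {d : ℕ} (x : Zd d) : ℝ := ∑' n, heat n x

theorem green_nonneg {d : ℕ} (x : Zd d) : 0 ≤ green x := tsum_nonneg fun n => heat_nonneg n x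

theorem green_neg {d : ℕ} (x : Zd d) : green (-x) = green x := by simp [green, heat_neg]

theorem sum_heat_le_green {d : ℕ} (hd : 3 ≤ d) (x : Zd d) (n : ℕ) :
    ∑ k ∈ Finset.range n, heat k x ≤ green x :=
  (summable_heat hd x).sum_le_tsum _ fun k _ => heat_nonneg k x

theorem avg_green_le {d : ℕ} (hd : 3 ≤ d) (x : Zd d) : avg d green x ≤ green x := by
  have h1 : HasSum (fun n => heat (n + 1) x) (avg d green x) := by
    simp only [heat_succ, avg_apply]
    refine HasSum.mul_left _ (hasSum_sum fun i _ => ?_)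
    exact (summable_heat hd _).hasSum.add (summable_heat hd _).hasSum
  rw [green, (summable_heat hd x).tsum_eq_zero_add, h1.tsum_eq]
  linarith [heat_nonneg 0 x]

theorem sum_range_inv_sqrt_le (n : ℕ) :
    ∑ k ∈ Finset.range n, 1 / Real.sqrt (k + 1) ≤ 2 * Real.sqrt n := by
  induction n with
  | zero => simp
  | succ n ih =>
    rw [Finset.sum_range_succ]
    have h1 : 0 < Real.sqrt (n + 1) := by positivity
    have h2 : Real.sqrt n ^ 2 = n := Real.sq_sqrt (by positivity)
    have h3 : Real.sqrt (n + 1) ^ 2 = n + 1 := Real.sq_sqrt (by positivity)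
    have h4 : 1 / Real.sqrt (n + 1) ≤ 2 * Real.sqrt (n + 1) - 2 * Real.sqrt n := by
      rw [div_le_iff₀ h1]
      nlinarith [sq_nonneg (Real.sqrt (n + 1) - Real.sqrt n)]
    push_cast
    linarith

/-- In dimension three Green's function decays at least like the inverse distance. -/
theorem exists_green_le_three :
    ∃ C : ℝ, 0 < C ∧ ∀ (x : Zd 3) (r : ℝ), 0 < r → r ^ 2 ≤ nsq x → green x ≤ C / r := by
  obtain ⟨C, hC, h1, h2⟩ := exists_nsq_mul_heat_le (d := 3) (by norm_num)
  suffices key : ∀ (x : Zd 3) (r : ℝ), 1 ≤ r → r ^ 2 ≤ nsq x → green x ≤ 8 * C / r by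
    refine ⟨8 * C, by positivity, fun x r hr hx => ?_⟩
    rcases le_or_gt 1 r with h | h
    · exact key x r h hx
    · have hz : nsq x = ((∑ i, x i ^ 2 : ℤ) : ℝ) := by simp [nsq]
      have h0 : 0 < nsq x := lt_of_lt_of_le (by positivity) hx
      have h1 : 1 ≤ nsq x := by
        rw [hz] at h0 ⊢
        exact_mod_cast Int.cast_pos.mp h0
      refine (key x 1 le_rfl (by linarith)).trans ?_
      exact div_le_div_of_nonneg_left (by positivity) hr h.le
  intro x r hr hx
  have hr0 : 0 < r := by linarith
  have hs : ∀ n : ℕ, 0 < Real.sqrt (n + 1) := fun n => by positivity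
  have hq : ∀ n : ℕ, Real.sqrt (n + 1) ^ 2 = n + 1 := fun n => Real.sq_sqrt (by positivity)
  -- early times
  have ha : ∀ n : ℕ, ∑ k ∈ Finset.range n, heat k x ≤ C / r ^ 2 * (2 * Real.sqrt n) := by
    intro n
    refine le_trans ?_ (mul_le_mul_of_nonneg_left (sum_range_inv_sqrt_le n) (by positivity))
    rw [Finset.mul_sum]
    refine Finset.sum_le_sum fun k _ => ?_
    have h3 : r ^ 2 * heat k x ≤ C / Real.sqrt (k + 1) := by
      refine (mul_le_mul_of_nonneg_right hx (heat_nonneg _ _)).trans ((h2 k x).trans (le_of_eq ?_))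
      rw [pow_succ (Real.sqrt _) 2, hq]
      have := hs k
      field_simp
    calc heat k x ≤ C / Real.sqrt (k + 1) / r ^ 2 := by
          rw [le_div_iff₀ (by positivity)]; linarith
      _ = _ := by ring
  -- late times
  have hb : ∀ m n : ℕ, 1 ≤ m → ∑ k ∈ Finset.range n, heat (m + k) x ≤
      3 * C * (1 / Real.sqrt m - 1 / Real.sqrt (m + n : ℕ)) := by
    intro m n hm
    induction n with
    | zero => simp
    | succ n ih =>
      rw [Finset.sum_range_succ]
      set t : ℝ := Real.sqrt (m + n : ℕ) with ht
      set s : ℝ := Real.sqrt (m + (n + 1) : ℕ) with hs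
      have ht0 : 1 ≤ t := by
        rw [ht, Real.one_le_sqrt]; exact_mod_cast (by omega)
      have ht2 : t ^ 2 = m + n := by rw [ht, Real.sq_sqrt (by positivity)]; push_cast; ring
      have hs2 : s ^ 2 = m + n + 1 := by rw [hs, Real.sq_sqrt (by positivity)]; push_cast; ring
      have hs0 : 0 < s := by rw [hs]; exact Real.sqrt_pos.mpr (by positivity)
      have hts : t ≤ s := by rw [ht, hs]; exact Real.sqrt_le_sqrt (by push_cast; linarith)
      have e1 : heat (m + n) x ≤ C / s ^ 3 := by
        have := h1 (m + n) x
        rwa [show (((m + n : ℕ) : ℝ) + 1) = ((m + (n + 1) : ℕ) : ℝ) by push_cast; ring] at this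
      have e2 : 1 / s ^ 3 ≤ 3 * (1 / t - 1 / s) := by
        have ht0' : 0 < t := by linarith
        rw [div_sub_div _ _ ht0'.ne' hs0.ne', ← mul_div_assoc, div_le_div_iff₀ (by positivity)
          (by positivity)]
        have e3 : (s - t) * (s + t) = 1 := by linarith [ht2, hs2, sq_sub_sq s t]
        have e4 : 1 ≤ (s - t) * (2 * s) := by nlinarith
        have e5 := mul_le_mul_of_nonneg_left e4 (mul_pos hs0 hs0).le
        have e6 := mul_le_mul_of_nonneg_left hts hs0.le
        have e7 := mul_pos hs0 hs0
        ring_nf at e5 e6 e7 ⊢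
        linarith
      have e5 : C / s ^ 3 ≤ 3 * C * (1 / t - 1 / s) := by
        calc C / s ^ 3 = C * (1 / s ^ 3) := by ring
          _ ≤ C * (3 * (1 / t - 1 / s)) := mul_le_mul_of_nonneg_left e2 hC.le
          _ = _ := by ring
      linarith
  set m := ⌈r ^ 2⌉₊ with hm
  have hm1 : r ^ 2 ≤ m := Nat.le_ceil _
  have hm2 : (m : ℝ) < r ^ 2 + 1 := Nat.ceil_lt_add_one (by positivity)
  have hm3 : 1 ≤ m := by
    have : (1 : ℝ) ≤ m := by nlinarith
    exact_mod_cast this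
  have hsm : r ≤ Real.sqrt m := by rw [Real.le_sqrt' hr0]; exact hm1
  have hsm' : Real.sqrt m ≤ 2 * r := by
    rw [Real.sqrt_le_left (by positivity)]; nlinarith
  have htail : ∑' k, heat (m + k) x ≤ 3 * C / r := by
    refine Real.tsum_le_of_sum_range_le (fun k => heat_nonneg _ _) fun n => ?_
    refine (hb m n hm3).trans ?_
    rw [mul_div_assoc, mul_assoc]
    refine mul_le_mul_of_nonneg_left ?_ (by norm_num)
    rw [div_eq_mul_one_div C r]
    refine mul_le_mul_of_nonneg_left ?_ hC.le
    have e1 : 1 / Real.sqrt m ≤ 1 / r := one_div_le_one_div_of_le hr0 hsm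
    have e2 : 0 ≤ 1 / Real.sqrt (m + n : ℕ) := by positivity
    linarith
  have hhead : ∑ k ∈ Finset.range m, heat k x ≤ 4 * C / r := by
    refine (ha m).trans ?_
    calc C / r ^ 2 * (2 * Real.sqrt m) ≤ C / r ^ 2 * (2 * (2 * r)) := by gcongr
      _ = 4 * C / r := by field_simp; norm_num
  rw [green, ← (summable_heat le_rfl x).sum_add_tsum_nat_add m]
  simp only [add_comm _ m]
  have : 8 * C / r = 3 * C / r + 4 * C / r + C / r := by ring
  have : 0 ≤ C / r := by positivity
  linarith

theorem exists_green_le_of_four_le {d : ℕ} (hd : 4 ≤ d) :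
    ∃ C : ℝ, 0 < C ∧ ∀ (x : Zd d) (r : ℝ), 0 < r → r ^ 2 ≤ nsq x →
      green x ≤ C / (r * Real.sqrt r) := by
  obtain ⟨C, hC, h1, h2⟩ := exists_nsq_mul_heat_le (d := d) (by omega)
  have hsum : Summable fun n : ℕ => 1 / ((n + 1 : ℕ) : ℝ) ^ (5 / 4 : ℝ) :=
    (summable_nat_add_iff 1).mpr (Real.summable_one_div_nat_rpow.mpr (by norm_num))
  set S := ∑' n : ℕ, 1 / ((n + 1 : ℕ) : ℝ) ^ (5 / 4 : ℝ) with hS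
  have hS0 : 0 ≤ S := tsum_nonneg fun n => by positivity
  refine ⟨C * (S + 1), by positivity, fun x r hr hx => ?_⟩
  have key : ∀ n : ℕ, heat n x ≤
      C / (r * Real.sqrt r) * (1 / ((n + 1 : ℕ) : ℝ) ^ (5 / 4 : ℝ)) := by
    intro n
    set N : ℝ := ((n + 1 : ℕ) : ℝ) with hN
    have hN0 : 0 < N := by positivity
    have hN1 : 1 ≤ N := by rw [hN]; push_cast; linarith [n.cast_nonneg (α := ℝ)]
    have hp : N ^ 2 ≤ Real.sqrt N ^ d := by
      calc N ^ 2 = Real.sqrt N ^ 4 := by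
            rw [show Real.sqrt N ^ 4 = (Real.sqrt N ^ 2) ^ 2 by ring, Real.sq_sqrt hN0.le]
        _ ≤ _ := pow_le_pow_right₀ (by rwa [Real.one_le_sqrt]) hd
    have a1 : heat n x ≤ C / N ^ 2 := by
      refine (h1 n x).trans ?_
      rw [show (n : ℝ) + 1 = N by rw [hN]; push_cast; rfl]
      gcongr
    have a2 : heat n x ≤ C / (N * r ^ 2) := by
      have : r ^ 2 * heat n x ≤ C / N := by
        refine (mul_le_mul_of_nonneg_right hx (heat_nonneg _ _)).trans ((h2 n x).trans ?_)
        rw [show (n : ℝ) + 1 = N by rw [hN]; push_cast; rfl]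
        calc C * N / Real.sqrt N ^ d ≤ C * N / N ^ 2 := by gcongr
          _ = C / N := by field_simp
      rw [← div_div, le_div_iff₀ (by positivity)]
      linarith
    have hh := heat_nonneg n x
    rw [← pow_le_pow_iff_left₀ hh (by positivity) (by norm_num : 4 ≠ 0)]
    have hrp : (N ^ (5 / 4 : ℝ)) ^ 4 = N ^ 5 := by
      rw [← Real.rpow_natCast, ← Real.rpow_mul hN0.le, ← Real.rpow_natCast]
      norm_num
    have hsr : Real.sqrt r ^ 4 = r ^ 2 := by
      rw [show Real.sqrt r ^ 4 = (Real.sqrt r ^ 2) ^ 2 by ring, Real.sq_sqrt hr.le]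
    calc heat n x ^ 4 = heat n x * heat n x ^ 3 := by ring
      _ ≤ C / N ^ 2 * (C / (N * r ^ 2)) ^ 3 := by gcongr
      _ = _ := by
        rw [mul_pow (C / (r * √r)), div_pow C (r * √r), mul_pow r, div_pow 1, hrp, hsr]
        field_simp
  calc green x ≤ ∑' n : ℕ, C / (r * Real.sqrt r) * (1 / ((n + 1 : ℕ) : ℝ) ^ (5 / 4 : ℝ)) :=
        (summable_heat (by omega) x).tsum_le_tsum key (hsum.mul_left _)
    _ = C / (r * Real.sqrt r) * S := by rw [tsum_mul_left]
    _ ≤ _ := by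
        rw [mul_div_right_comm]
        exact mul_le_mul_of_nonneg_left (by linarith) (by positivity)

theorem avg_pow_congr {d : ℕ} (n : ℕ) {f g : Zd d → ℝ} (x : Zd d)
    (h : ∀ y : Zd d, (∀ i, |y i - x i| ≤ n) → f y = g y) : (avg d ^ n) f x = (avg d ^ n) g x := by
  induction n generalizing x with
  | zero => exact h x (by simp)
  | succ n ih =>
    rw [avg_pow_succ, avg_pow_succ, avg_apply, avg_apply]
    congr 1
    refine Finset.sum_congr rfl fun i _ => ?_
    have hu : ∀ j, |(unitVec i : Zd d) j| ≤ 1 := by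
      intro j
      by_cases hj : j = i
      · subst hj; simp [unitVec]
      · simp [unitVec, hj]
    congr 1
    · refine ih _ fun y hy => h y fun j => ?_
      have h1 := hy j
      have h2 := hu j
      rw [Pi.add_apply] at h1
      rw [abs_le] at *
      push_cast
      omega
    · refine ih _ fun y hy => h y fun j => ?_
      have h1 := hy j
      have h2 := hu j
      rw [Pi.sub_apply] at h1
      rw [abs_le] at *
      push_cast
      omega

open Classical in
/-- The indicator of the line through `v` in direction `a`. -/
noncomputable def lineInd {d : ℕ} (a : Fin d) (v y : Zd d) : ℝ := if ∀ i ≠ a, y i = v i then 1 else 0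

theorem lineInd_nonneg {d : ℕ} (a : Fin d) (v y : Zd d) : 0 ≤ lineInd a v y := by
  unfold lineInd; split_ifs <;> norm_num

/-- The points of the box of radius `ρ` orthogonal to the direction `a`. -/
noncomputable def crossBox {d : ℕ} (a : Fin d) (ρ : ℕ) : Finset (Zd d) :=
  Fintype.piFinset fun i => if i = a then {0} else Finset.Icc (-(ρ : ℤ)) ρ

theorem card_crossBox (a : Fin 3) (ρ : ℕ) : (crossBox a ρ).card = (2 * ρ + 1) ^ 2 := by
  rw [crossBox, Fintype.card_piFinset, Fin.prod_univ_three]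
  have h : (Finset.Icc (-(ρ : ℤ)) ρ).card = 2 * ρ + 1 := by simp; omega
  fin_cases a <;> simp only [Fin.reduceFinMk, Fin.isValue, Fin.zero_eta, Fin.mk_one,
      Fin.reduceEq, ↓reduceIte, Finset.card_singleton, h] <;> ring

theorem sum_lineInd_ge {d : ℕ} (a : Fin d) {ρ : ℕ} (hρ : 0 < ρ) (y : Zd d) :
    1 - nsq y / ρ ^ 2 ≤ ∑ v ∈ crossBox a ρ, lineInd a v y := by
  by_cases h : ∀ i ≠ a, |y i| ≤ ρ
  · have hm : Function.update y a 0 ∈ crossBox a ρ := by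
      rw [crossBox, Fintype.mem_piFinset]
      intro i
      by_cases hi : i = a
      · subst hi; simp
      · simpa [hi, abs_le] using h i hi
    refine le_trans ?_ (Finset.single_le_sum (fun v _ => lineInd_nonneg a v y) hm)
    have : lineInd a (Function.update y a 0) y = 1 := by
      rw [lineInd, if_pos]
      intro i hi
      simp [hi]
    rw [this]
    have : 0 ≤ nsq y / ρ ^ 2 := div_nonneg (nsq_nonneg y) (by positivity)
    linarith
  · push Not at h
    obtain ⟨i, -, hi⟩ := h
    refine le_trans ?_ (Finset.sum_nonneg fun v _ => lineInd_nonneg a v y)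
    have h1 : (ρ : ℝ) ^ 2 ≤ nsq y := by
      refine le_trans ?_ (Finset.single_le_sum (f := fun i => (y i : ℝ) ^ 2)
        (fun _ _ => sq_nonneg _) (Finset.mem_univ i))
      rw [← sq_abs (y i : ℝ)]
      have : (ρ : ℝ) ≤ |(y i : ℝ)| := by exact_mod_cast hi.le
      gcongr
    have : 1 ≤ nsq y / ρ ^ 2 := by rwa [one_le_div (by positivity)]
    linarith

theorem avg_pow_lineInd_neg {d : ℕ} (n : ℕ) (a : Fin d) (v y : Zd d) (h : ∀ i ≠ a, y i = v i) :
    (avg d ^ n) (lineInd a 0) y = (avg d ^ n) (lineInd a v) 0 := by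
  have h1 := avg_pow_reflect n (lineInd a v) 0
  rw [neg_zero] at h1
  rw [← h1]
  have h2 := avg_pow_translate n (lineInd a 0) y 0
  rw [zero_add] at h2
  rw [← h2]
  refine congrFun (congrArg _ (funext fun z => ?_)) _
  unfold lineInd
  congr 1
  refine propext (forall₂_congr fun i hi => ?_)
  have := h i hi
  simp only [Pi.add_apply, Pi.zero_apply, Pi.neg_apply]
  omega

theorem avg_pow_lineInd_ge (a : Fin 3) {n : ℕ} (hn : 0 < n) :
    1 / (136 * n) ≤ (avg 3 ^ (2 * n)) (lineInd a 0) 0 := by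
  set ρ := Nat.sqrt (2 * n) + 1 with hρ
  have hρ1 : 2 * n < ρ ^ 2 := Nat.lt_succ_sqrt' _
  have hρ2 : (ρ - 1) ^ 2 ≤ 2 * n := Nat.sqrt_le' _
  have hρ0 : 0 < ρ := by omega
  set α : Zd 3 → ℝ := fun v => (avg 3 ^ n) (lineInd a v) 0 with hα
  have h1 : 1 / 2 ≤ ∑ v ∈ crossBox a ρ, α v := by
    have e : ∑ v ∈ crossBox a ρ, α v = (avg 3 ^ n) (∑ v ∈ crossBox a ρ, lineInd a v) 0 := by
      rw [map_sum, Finset.sum_apply]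
    rw [e]
    have e2 : (avg 3 ^ n) ((fun _ => (1 : ℝ)) - ((ρ : ℝ) ^ 2)⁻¹ • nsq) 0 ≤
        (avg 3 ^ n) (∑ v ∈ crossBox a ρ, lineInd a v) 0 := by
      refine avg_pow_mono n (fun y => ?_) 0
      rw [Finset.sum_apply]
      refine le_trans (le_of_eq ?_) (sum_lineInd_ge a hρ0 y)
      simp only [Pi.sub_apply, Pi.smul_apply, smul_eq_mul]
      ring
    refine le_trans ?_ e2
    rw [map_sub, map_smul, Pi.sub_apply, Pi.smul_apply, avg_pow_nsq (by norm_num),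
      avg_pow_const (by norm_num)]
    have e3 : (2 * n : ℝ) ≤ ρ ^ 2 := by exact_mod_cast hρ1.le
    have e4 : ((ρ : ℝ) ^ 2)⁻¹ * n ≤ 1 / 2 := by
      rw [inv_mul_le_iff₀ (by positivity)]; linarith
    simp only [nsq, smul_eq_mul]
    simpa using by linarith
  have h2 : ∑ v ∈ crossBox a ρ, α v ^ 2 ≤ (avg 3 ^ (2 * n)) (lineInd a 0) 0 := by
    rw [two_mul, avg_pow_add]
    have e : ∑ v ∈ crossBox a ρ, α v ^ 2 =
        (avg 3 ^ n) (∑ v ∈ crossBox a ρ, α v • lineInd a v) 0 := by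
      rw [map_sum, Finset.sum_apply]
      refine Finset.sum_congr rfl fun v _ => ?_
      rw [map_smul, Pi.smul_apply, smul_eq_mul, sq]
    rw [e]
    refine avg_pow_mono n (fun y => ?_) 0
    rw [Finset.sum_apply]
    by_cases h : ∃ v ∈ crossBox a ρ, ∀ i ≠ a, y i = v i
    · obtain ⟨v, hv, hy⟩ := h
      rw [Finset.sum_eq_single_of_mem v hv]
      · rw [Pi.smul_apply, lineInd, if_pos hy, avg_pow_lineInd_neg n a v y hy]
        simp [hα]
      · intro w hw hwv
        rw [Pi.smul_apply, lineInd, if_neg, smul_zero]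
        intro hyw
        apply hwv
        ext i
        by_cases hi : i = a
        · rw [crossBox, Fintype.mem_piFinset] at hv hw
          have h1 := hv i
          have h2 := hw i
          simp only [hi, ↓reduceIte, Finset.mem_singleton] at h1 h2
          rw [hi, h1, h2]
        · rw [← hy i hi, hyw i hi]
    · push Not at h
      refine (Finset.sum_nonpos fun v hv => ?_).trans
        (avg_pow_nonneg n (fun z => lineInd_nonneg a 0 z) y)
      rw [Pi.smul_apply, lineInd, if_neg (by simpa using h v hv), smul_zero]
  have h3 := sq_sum_le_card_mul_sum_sq (s := crossBox a ρ) (f := α)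
  rw [card_crossBox] at h3
  have h4 : ((2 * ρ + 1) ^ 2 : ℝ) ≤ 34 * n := by
    have : (2 * ρ + 1) ^ 2 ≤ 34 * n := by
      obtain ⟨s, hs⟩ : ∃ s, ρ = s + 1 := ⟨_, hρ⟩
      rw [hs] at hρ2 ⊢
      simp only [add_tsub_cancel_right] at hρ2
      nlinarith [sq_nonneg ((s : ℤ) - 1), sq_nonneg (2 * (s : ℤ) - 3)]
    exact_mod_cast this
  have h5 : (1 / 2 : ℝ) ^ 2 ≤ (∑ v ∈ crossBox a ρ, α v) ^ 2 := by gcongr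
  have h6 : (0 : ℝ) ≤ ∑ v ∈ crossBox a ρ, α v ^ 2 := Finset.sum_nonneg fun _ _ => sq_nonneg _
  have h7 : (0 : ℝ) < n := by exact_mod_cast hn
  refine le_trans ?_ h2
  rw [div_le_iff₀ (by positivity)]
  push_cast at h3
  nlinarith [mul_le_mul_of_nonneg_right h4 h6]

theorem sum_heat_axis_ge (a : Fin 3) {n : ℕ} (hn : 0 < n) :
    1 / (272 * n) ≤ ∑ k ∈ Finset.range (2 * n + 1), heat (2 * n) ((k : ℤ) • (unitVec a : Zd 3)) := by
  have h1 := avg_pow_lineInd_ge a hn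
  set g : Zd 3 → ℝ := ∑ k ∈ Finset.range (2 * n + 1),
    ((fun z => if z = (k : ℤ) • (unitVec a : Zd 3) then (1 : ℝ) else 0) +
      fun z => if z = -((k : ℤ) • (unitVec a : Zd 3)) then (1 : ℝ) else 0) with hg
  have hg0 : 0 ≤ g := by
    rw [hg]
    refine Finset.sum_nonneg fun k _ => ?_
    intro z
    simp only [Pi.zero_apply, Pi.add_apply]
    positivity
  have h2 : (avg 3 ^ (2 * n)) (lineInd a 0) 0 ≤ (avg 3 ^ (2 * n)) g 0 := by
    classical
    rw [avg_pow_congr (2 * n) (g := fun y => if ∀ i, |y i| ≤ (2 * n : ℕ) then lineInd a 0 y else 0) 0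
      (fun y hy => by rw [if_pos]; simpa using hy)]
    refine avg_pow_mono _ (fun y => ?_) 0
    dsimp only
    split_ifs with hy
    · by_cases hl : ∀ i ≠ a, y i = (0 : Zd 3) i
      · rw [lineInd, if_pos hl, hg, Finset.sum_apply]
        have hya : y = (y a) • (unitVec a : Zd 3) := by
          ext i
          by_cases hi : i = a
          · subst hi; simp [unitVec]
          · simp [unitVec, hi, hl i hi]
        have hk : (y a).natAbs ∈ Finset.range (2 * n + 1) := by
          have := hy a
          rw [abs_le] at this
          rw [Finset.mem_range]; omega
        refine le_trans ?_ (Finset.single_le_sum (fun k _ => ?_) hk)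
        · simp only [Pi.add_apply]
          rcases Int.natAbs_eq (y a) with h | h
          · rw [if_pos (by rw [← h]; exact hya)]
            have : (0 : ℝ) ≤ if y = -(((y a).natAbs : ℤ) • (unitVec a : Zd 3)) then (1 : ℝ) else 0 := by
              positivity
            linarith
          · rw [if_pos (c := y = -(((y a).natAbs : ℤ) • (unitVec a : Zd 3)))
              (by rw [← neg_smul, ← h]; exact hya)]
            have : (0 : ℝ) ≤ if y = (((y a).natAbs : ℤ) • (unitVec a : Zd 3)) then (1 : ℝ) else 0 := by
              positivity
            linarith
        · simp only [Pi.add_apply]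
          positivity
      · rw [lineInd, if_neg hl]; exact hg0 y
    · exact hg0 y
  have h3 : (avg 3 ^ (2 * n)) g 0 =
      ∑ k ∈ Finset.range (2 * n + 1), 2 * heat (2 * n) ((k : ℤ) • (unitVec a : Zd 3)) := by
    rw [hg, map_sum, Finset.sum_apply]
    refine Finset.sum_congr rfl fun k _ => ?_
    rw [map_add, Pi.add_apply, avg_pow_single, avg_pow_single, zero_sub, heat_neg, sub_neg_eq_add,
      zero_add]
    ring
  rw [h3, ← Finset.mul_sum] at h2
  have : (1 : ℝ) / (272 * n) = 1 / (136 * n) / 2 := by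
    rw [div_div]; ring
  linarith

theorem log_le_sum_green_axis (a : Fin 3) {M : ℕ} (hM : 1 ≤ M) :
    Real.log M / 544 ≤ ∑ k ∈ Finset.range (M + 1), green ((k : ℤ) • (unitVec a : Zd 3)) := by
  have h1 : ∀ k : ℕ, ∑ n ∈ Finset.range (M / 2),
      heat (2 * (n + 1)) ((k : ℤ) • (unitVec a : Zd 3)) ≤ green ((k : ℤ) • (unitVec a : Zd 3)) := by
    intro k
    rw [← Finset.sum_image (f := fun j => heat j ((k : ℤ) • (unitVec a : Zd 3)))
      (g := fun n => 2 * (n + 1)) (fun x _ y _ h => by simpa using h)]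
    exact (summable_heat le_rfl _).sum_le_tsum _ fun j _ => heat_nonneg j _
  refine le_trans ?_ (Finset.sum_le_sum fun k _ => h1 k)
  rw [Finset.sum_comm]
  have h2 : ∀ n ∈ Finset.range (M / 2), 1 / 272 * ((n + 1 : ℕ) : ℝ)⁻¹ ≤
      ∑ k ∈ Finset.range (M + 1), heat (2 * (n + 1)) ((k : ℤ) • (unitVec a : Zd 3)) := by
    intro n hn
    rw [Finset.mem_range] at hn
    calc 1 / 272 * ((n + 1 : ℕ) : ℝ)⁻¹ = 1 / (272 * ((n + 1 : ℕ) : ℝ)) := by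
          rw [← div_div]; rfl
      _ ≤ _ := sum_heat_axis_ge a n.succ_pos
      _ ≤ _ := Finset.sum_le_sum_of_subset_of_nonneg
          (Finset.range_subset_range.mpr (by omega)) fun _ _ _ => heat_nonneg _ _
  refine le_trans ?_ (Finset.sum_le_sum h2)
  rw [← Finset.mul_sum]
  have h3 : Real.log ((M / 2 + 1 : ℕ) : ℝ) ≤ ∑ n ∈ Finset.range (M / 2), ((n + 1 : ℕ) : ℝ)⁻¹ := by
    have := log_add_one_le_harmonic (M / 2)
    rw [harmonic] at this
    push_cast at this ⊢
    exact this
  have h4 : Real.log M ≤ 2 * Real.log ((M / 2 + 1 : ℕ) : ℝ) := by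
    rw [← Real.log_rpow (by positivity)]
    refine Real.log_le_log (by exact_mod_cast hM) ?_
    have : M ≤ (M / 2 + 1) ^ 2 := by
      have : M ≤ 2 * (M / 2) + 1 := by omega
      nlinarith
    norm_cast
  linarith

/-- The point of the plane `ℤ e₁ + ℤ e₂` with the given coordinates. -/
def planePt (d : ℕ) (p : ℤ × ℤ) : Zd d :=
  fun i => if (i : ℕ) = 0 then p.1 else if (i : ℕ) = 1 then p.2 else 0

theorem planePt_sub {d : ℕ} (p q : ℤ × ℤ) : planePt d p - planePt d q = planePt d (p - q) := by
  ext i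
  simp only [planePt, Pi.sub_apply, Prod.fst_sub, Prod.snd_sub]
  split_ifs <;> simp

/-- The boundary of the square of radius `R` in the plane. -/
noncomputable def squareBdry (R : ℕ) : Finset (ℤ × ℤ) :=
  ({-(R : ℤ), (R : ℤ)} ×ˢ Finset.Icc (-(R : ℤ)) R) ∪ (Finset.Icc (-(R : ℤ)) R ×ˢ {-(R : ℤ), (R : ℤ)})

theorem mem_squareBdry {R : ℕ} {p : ℤ × ℤ} : p ∈ squareBdry R ↔
    ((p.1 = -R ∨ p.1 = R) ∧ -(R : ℤ) ≤ p.2 ∧ p.2 ≤ R) ∨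
      ((-(R : ℤ) ≤ p.1 ∧ p.1 ≤ R) ∧ (p.2 = -R ∨ p.2 = R)) := by
  simp [squareBdry]

theorem card_squareBdry_le {R : ℕ} (hR : 1 ≤ R) : (squareBdry R).card ≤ 12 * R := by
  have h : (Finset.Icc (-(R : ℤ)) R).card = 2 * R + 1 := by simp; omega
  have h2 : ({-(R : ℤ), (R : ℤ)} : Finset ℤ).card ≤ 2 := Finset.card_le_two
  refine (Finset.card_union_le _ _).trans ?_
  rw [Finset.card_product, Finset.card_product, h]
  nlinarith

theorem exists_segment_squareBdry {R : ℕ} {t : ℤ × ℤ} (ht : t ∈ squareBdry R) :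
    ∃ v ∈ ({(1, 0), (-1, 0), (0, 1), (0, -1)} : Finset (ℤ × ℤ)),
      ∀ k ∈ Finset.range (R + 1), t + (k : ℤ) • v ∈ squareBdry R := by
  rw [mem_squareBdry] at ht
  rcases ht with ⟨h1, h2, h3⟩ | ⟨⟨h2, h3⟩, h1⟩
  · rcases le_total t.2 0 with h | h
    · refine ⟨(0, 1), by simp, fun k hk => ?_⟩
      rw [Finset.mem_range] at hk
      rw [mem_squareBdry]
      simp
      omega
    · refine ⟨(0, -1), by simp, fun k hk => ?_⟩
      rw [Finset.mem_range] at hk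
      rw [mem_squareBdry]
      simp
      omega
  · rcases le_total t.1 0 with h | h
    · refine ⟨(1, 0), by simp, fun k hk => ?_⟩
      rw [Finset.mem_range] at hk
      rw [mem_squareBdry]
      simp
      omega
    · refine ⟨(-1, 0), by simp, fun k hk => ?_⟩
      rw [Finset.mem_range] at hk
      rw [mem_squareBdry]
      simp
      omega

/-- The boundary of the square of radius `R` around `R • w`, as a subset of `ℤ^d`. -/
noncomputable def ring (d R : ℕ) (w : ℤ × ℤ) : Finset (Zd d) :=
  (squareBdry R).image fun s => planePt d ((R : ℤ) • w + s)

/-- The sum of Green's functions of the points of a ring. -/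
noncomputable def ringGreen (d R : ℕ) (w : ℤ × ℤ) (x : Zd d) : ℝ :=
  ∑ s ∈ squareBdry R, green (x - planePt d ((R : ℤ) • w + s))

theorem ringGreen_nonneg {d R : ℕ} (w : ℤ × ℤ) (x : Zd d) : 0 ≤ ringGreen d R w x :=
  Finset.sum_nonneg fun _ _ => green_nonneg _

theorem avg_sub_apply {d : ℕ} (f : Zd d → ℝ) (a x : Zd d) :
    avg d (fun y => f (y - a)) x = avg d f (x - a) := by
  have := avg_pow_translate 1 f (-a) x
  simpa [sub_eq_add_neg] using this

theorem avg_ringGreen_le {d R : ℕ} (hd : 3 ≤ d) (w : ℤ × ℤ) (x : Zd d) :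
    avg d (ringGreen d R w) x ≤ ringGreen d R w x := by
  have : ringGreen d R w =
      ∑ s ∈ squareBdry R, fun x => green (x - planePt d ((R : ℤ) • w + s)) := by
    ext y; rw [Finset.sum_apply]; rfl
  rw [this, map_sum, Finset.sum_apply, Finset.sum_apply]
  refine Finset.sum_le_sum fun s _ => ?_
  rw [avg_sub_apply]
  exact avg_green_le hd _

theorem ringGreen_three_ge {R : ℕ} (hR : 1 ≤ R) {w : ℤ × ℤ} {x : Zd 3} (hx : x ∈ ring 3 R w) :
    Real.log R / 544 ≤ ringGreen 3 R w x := by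
  obtain ⟨t, ht, rfl⟩ := Finset.mem_image.mp hx
  obtain ⟨v, hv, hk⟩ := exists_segment_squareBdry ht
  have e : ∀ k : ℕ, planePt 3 ((R : ℤ) • w + t) - planePt 3 ((R : ℤ) • w + (t + (k : ℤ) • v)) =
      -((k : ℤ) • planePt 3 v) := by
    intro k
    rw [planePt_sub]
    ext i
    fin_cases i <;> simp [planePt]
  have hg : ∀ k : ℕ, ∃ a : Fin 3, ∀ k : ℤ, green (k • planePt 3 v) = green (k • (unitVec a : Zd 3)) := by
    intro k
    have h0 : planePt 3 (1, 0) = unitVec 0 := by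
      ext i; fin_cases i <;> simp [planePt, unitVec]
    have h1 : planePt 3 (0, 1) = unitVec 1 := by
      ext i; fin_cases i <;> simp [planePt, unitVec]
    have h2 : planePt 3 (-1, 0) = -unitVec 0 := by
      ext i; fin_cases i <;> simp [planePt, unitVec]
    have h3 : planePt 3 (0, -1) = -unitVec 1 := by
      ext i; fin_cases i <;> simp [planePt, unitVec]
    simp only [Finset.mem_insert, Finset.mem_singleton] at hv
    rcases hv with rfl | rfl | rfl | rfl
    · exact ⟨0, fun k => by rw [h0]⟩
    · exact ⟨0, fun k => by rw [h2, smul_neg, green_neg]⟩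
    · exact ⟨1, fun k => by rw [h1]⟩
    · exact ⟨1, fun k => by rw [h3, smul_neg, green_neg]⟩
  obtain ⟨a, ha⟩ := hg 0
  refine (log_le_sum_green_axis a hR).trans ?_
  have hinj : Set.InjOn (fun k : ℕ => t + (k : ℤ) • v) (Finset.range (R + 1) : Set ℕ) := by
    intro k _ l _ h
    simp only [add_right_inj] at h
    have h1 := congrArg Prod.fst h
    have h2 := congrArg Prod.snd h
    simp only [Finset.mem_insert, Finset.mem_singleton] at hv
    rcases hv with rfl | rfl | rfl | rfl <;> simp at h1 h2 <;> omega
  calc ∑ k ∈ Finset.range (R + 1), green ((k : ℤ) • (unitVec a : Zd 3))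
      = ∑ k ∈ Finset.range (R + 1), green (planePt 3 ((R : ℤ) • w + t) -
          planePt 3 ((R : ℤ) • w + (t + (k : ℤ) • v))) := by
        refine Finset.sum_congr rfl fun k _ => ?_
        rw [e, green_neg, ha]
    _ = ∑ s ∈ (Finset.range (R + 1)).image (fun k : ℕ => t + (k : ℤ) • v),
          green (planePt 3 ((R : ℤ) • w + t) - planePt 3 ((R : ℤ) • w + s)) := by
        rw [Finset.sum_image hinj]
    _ ≤ _ := Finset.sum_le_sum_of_subset_of_nonneg (Finset.image_subset_iff.mpr hk)
        fun _ _ _ => green_nonneg _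

theorem one_le_ringGreen {d R : ℕ} (hd : 3 ≤ d) {w : ℤ × ℤ} {x : Zd d} (hx : x ∈ ring d R w) :
    1 ≤ ringGreen d R w x := by
  obtain ⟨t, ht, rfl⟩ := Finset.mem_image.mp hx
  refine le_trans ?_ (Finset.single_le_sum (fun s _ => green_nonneg _) ht)
  rw [sub_self]
  have := sum_heat_le_green hd (0 : Zd d) 1
  simpa [heat] using this

/-- The supremum distance in the plane. -/
def supDist (w w' : ℤ × ℤ) : ℤ := max |w.1 - w'.1| |w.2 - w'.2|

theorem supDist_comm (w w' : ℤ × ℤ) : supDist w w' = supDist w' w := by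
  rw [supDist, supDist, abs_sub_comm, abs_sub_comm w.2]

theorem sq_le_nsq_of_supDist {d R : ℕ} (hd : 3 ≤ d) {w w' s t : ℤ × ℤ} (hs : s ∈ squareBdry R)
    (ht : t ∈ squareBdry R) (h : 4 ≤ supDist w w') :
    ((R : ℝ) * supDist w w' / 2) ^ 2 ≤
      nsq (planePt d ((R : ℤ) • w + t) - planePt d ((R : ℤ) • w' + s)) := by
  have hbox : ∀ p ∈ squareBdry R, |p.1| ≤ R ∧ |p.2| ≤ R := by
    intro p hp
    rw [mem_squareBdry] at hp
    rw [abs_le, abs_le]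
    omega
  obtain ⟨hs1, hs2⟩ := hbox s hs
  obtain ⟨ht1, ht2⟩ := hbox t ht
  have key : ∀ a b : ℤ, |a| ≤ R → |b| ≤ R → ∀ c c' : ℤ, 4 ≤ |c - c'| →
      ((R : ℝ) * (|c - c'| : ℤ) / 2) ^ 2 ≤ (((R * c + a - (R * c' + b) : ℤ)) : ℝ) ^ 2 := by
    intro a b ha hb c c' hc
    rw [← sq_abs (((R * c + a - (R * c' + b) : ℤ)) : ℝ)]
    refine pow_le_pow_left₀ (by positivity) ?_ 2
    rw [div_le_iff₀ (by norm_num)]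
    have : (R : ℤ) * |c - c'| ≤ |R * c + a - (R * c' + b)| * 2 := by
      have h1 : |(R : ℤ) * (c - c')| ≤ |R * c + a - (R * c' + b)| + |b - a| := by
        calc _ = |(R * c + a - (R * c' + b)) + (b - a)| := by congr 1; ring
          _ ≤ _ := abs_add_le _ _
      have h2 : |b - a| ≤ |b| + |a| := abs_sub _ _
      rw [abs_mul, Nat.abs_cast] at h1
      nlinarith
    exact_mod_cast this
  rw [planePt_sub]
  have h0 : 0 < d := by omega
  have h1 : 1 < d := by omega
  rcases le_total |w.1 - w'.1| |w.2 - w'.2| with hm | hm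
  · rw [supDist, max_eq_right hm] at h ⊢
    refine (key t.2 s.2 ht2 hs2 w.2 w'.2 h).trans ?_
    refine le_trans (le_of_eq ?_) (Finset.single_le_sum (fun _ _ => sq_nonneg _)
      (Finset.mem_univ (⟨1, h1⟩ : Fin d)))
    simp [planePt]
  · rw [supDist, max_eq_left hm] at h ⊢
    refine (key t.1 s.1 ht1 hs1 w.1 w'.1 h).trans ?_
    refine le_trans (le_of_eq ?_) (Finset.single_le_sum (fun _ _ => sq_nonneg _)
      (Finset.mem_univ (⟨0, h0⟩ : Fin d)))
    simp [planePt]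

theorem disjoint_ring {d R : ℕ} (hd : 3 ≤ d) (hR : 1 ≤ R) {w w' : ℤ × ℤ} (h : 4 ≤ supDist w w') :
    Disjoint (ring d R w) (ring d R w') := by
  rw [Finset.disjoint_left]
  intro x hx hx'
  obtain ⟨t, ht, rfl⟩ := Finset.mem_image.mp hx
  obtain ⟨s, hs, hst⟩ := Finset.mem_image.mp hx'
  have := sq_le_nsq_of_supDist hd hs ht h
  rw [← hst, sub_self] at this
  have h1 : (0 : ℝ) < R := by exact_mod_cast hR
  have h2 : (0 : ℝ) < supDist w w' := by exact_mod_cast (by omega : 0 < supDist w w')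
  have h3 : 0 < ((R : ℝ) * supDist w w' / 2) ^ 2 := by positivity
  rw [show nsq (0 : Zd d) = 0 by simp [nsq]] at this
  linarith

theorem ringGreen_le {d R : ℕ} (hd : 3 ≤ d) (hR : 1 ≤ R) {w w' : ℤ × ℤ} {B : ℝ}
    (hB : ∀ z : Zd d, ((R : ℝ) * supDist w w' / 2) ^ 2 ≤ nsq z → green z ≤ B)
    (h : 4 ≤ supDist w w') {x : Zd d} (hx : x ∈ ring d R w) :
    ringGreen d R w' x ≤ 12 * R * B := by
  obtain ⟨t, ht, rfl⟩ := Finset.mem_image.mp hx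
  have h1 : ∀ s ∈ squareBdry R,
      green (planePt d ((R : ℤ) • w + t) - planePt d ((R : ℤ) • w' + s)) ≤ B :=
    fun s hs => hB _ (sq_le_nsq_of_supDist hd hs ht h)
  refine (Finset.sum_le_card_nsmul _ _ _ h1).trans ?_
  have hB0 : 0 ≤ B := (green_nonneg _).trans (h1 t ht)
  rw [nsmul_eq_mul]
  refine mul_le_mul_of_nonneg_right ?_ hB0
  exact_mod_cast card_squareBdry_le hR

theorem log_le_two_mul_sqrt {R : ℕ} (hR : 1 ≤ R) : Real.log R ≤ 2 * Real.sqrt R := by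
  have h0 : (0 : ℝ) < R := by exact_mod_cast hR
  have h : Real.log (Real.sqrt R) ≤ Real.sqrt R - 1 := Real.log_le_sub_one_of_pos (by positivity)
  rw [Real.log_sqrt h0.le] at h
  linarith

/-- Properly normalized, the Green potential of a ring is a small superharmonic function
that dominates the indicator of the ring. -/
theorem exists_ring_potential {d : ℕ} (hd : 3 ≤ d) : ∃ C : ℝ, 0 < C ∧ ∀ R : ℕ, 2 ≤ R →
    ∃ c : ℝ, 0 < c ∧ (∀ w, ∀ x ∈ ring d R w, 1 ≤ c * ringGreen d R w x) ∧
      (∀ w w', 4 ≤ supDist w w' → ∀ x ∈ ring d R w,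
        c * ringGreen d R w' x ≤ C / Real.log R * (1 / supDist w w')) ∧
      c * (squareBdry R).card ≤ C * (R : ℝ) ^ (d - 2) / Real.log R := by
  have hlog : ∀ R : ℕ, 2 ≤ R → 0 < Real.log R := fun R hR =>
    Real.log_pos (by exact_mod_cast (by omega : 1 < R))
  have hm0 : ∀ w w', 4 ≤ supDist w w' → (4 : ℝ) ≤ supDist w w' := fun w w' h => by exact_mod_cast h
  rcases hd.eq_or_lt with rfl | hd4
  · obtain ⟨C, hC, h⟩ := exists_green_le_three
    refine ⟨544 * 24 * C + 544 * 12, by positivity, fun R hR => ?_⟩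
    have hl := hlog R hR
    have hR0 : (0 : ℝ) < R := by exact_mod_cast (by omega : 0 < R)
    refine ⟨544 / Real.log R, by positivity, fun w x hx => ?_, fun w w' hw x hx => ?_, ?_⟩
    · have := ringGreen_three_ge (by omega) hx
      rw [div_le_iff₀ (by norm_num)] at this
      rw [div_mul_eq_mul_div, le_div_iff₀ hl]
      linarith
    · have hm := hm0 w w' hw
      have hm' : (0 : ℝ) < supDist w w' := by linarith
      have := ringGreen_le le_rfl (by omega)
        (fun z hz => h z ((R : ℝ) * supDist w w' / 2) (by positivity) hz) hw hx
      calc 544 / Real.log R * ringGreen 3 R w' x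
          ≤ 544 / Real.log R * (12 * R * (C / ((R : ℝ) * supDist w w' / 2))) := by gcongr
        _ = 544 * 24 * C / Real.log R * (1 / supDist w w') := by field_simp; norm_num
        _ ≤ _ := by gcongr; linarith
    · have : ((squareBdry R).card : ℝ) ≤ 12 * R := by exact_mod_cast card_squareBdry_le (by omega)
      calc 544 / Real.log R * ((squareBdry R).card : ℝ) ≤ 544 / Real.log R * (12 * R) := by gcongr
        _ = 544 * 12 * (R : ℝ) ^ 1 / Real.log R := by ring
        _ ≤ _ := by
          norm_num only
          gcongr
          have : 0 < C := hC
          linarith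
  · obtain ⟨C, hC, h⟩ := exists_green_le_of_four_le hd4
    refine ⟨48 * C + 12, by positivity, fun R hR => ?_⟩
    have hl := hlog R hR
    have hR1 : (1 : ℝ) ≤ R := by exact_mod_cast (by omega : 1 ≤ R)
    have hR0 : (0 : ℝ) < R := by linarith
    refine ⟨1, one_pos, fun w x hx => ?_, fun w w' hw x hx => ?_, ?_⟩
    · rw [one_mul]; exact one_le_ringGreen hd hx
    · rw [one_mul]
      have hm := hm0 w w' hw
      have hm' : (0 : ℝ) < supDist w w' := by linarith
      have := ringGreen_le hd (by omega)
        (fun z hz => h z ((R : ℝ) * supDist w w' / 2) (by positivity) hz) hw hx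
      refine this.trans ?_
      have hs : Real.sqrt R ≤ Real.sqrt ((R : ℝ) * supDist w w' / 2) :=
        Real.sqrt_le_sqrt (by nlinarith)
      have hs0 : 0 < Real.sqrt R := by positivity
      have hl2 := log_le_two_mul_sqrt (by omega : 1 ≤ R)
      calc 12 * R * (C / ((R : ℝ) * supDist w w' / 2 * Real.sqrt ((R : ℝ) * supDist w w' / 2)))
          ≤ 12 * R * (C / ((R : ℝ) * supDist w w' / 2 * (Real.log R / 2))) := by
            gcongr
            linarith
        _ = 48 * C / Real.log R * (1 / supDist w w') := by field_simp; norm_num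
        _ ≤ _ := by gcongr; linarith
    · have : ((squareBdry R).card : ℝ) ≤ 12 * R := by exact_mod_cast card_squareBdry_le (by omega)
      rw [one_mul, le_div_iff₀ hl]
      have h1 : Real.log R ≤ R := (Real.log_le_sub_one_of_pos hR0).trans (by linarith)
      have h2 : (R : ℝ) ^ 2 ≤ (R : ℝ) ^ (d - 2) := pow_le_pow_right₀ hR1 (by omega)
      calc ((squareBdry R).card : ℝ) * Real.log R ≤ 12 * R * R := by gcongr
        _ = 12 * (R : ℝ) ^ 2 := by ring
        _ ≤ (48 * C + 12) * (R : ℝ) ^ (d - 2) := by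
          gcongr
          linarith

theorem adj_iff {d : ℕ} {x y : Zd d} :
    adj x y ↔ ∃ i, y = x + unitVec i ∨ y = x - unitVec i := by
  constructor
  · intro h
    have h0 : ∃ i, x i ≠ y i := by
      by_contra! hc
      simp [adj, hc] at h
    obtain ⟨i, hi⟩ := h0
    have h1 : |x i - y i| + ∑ j ∈ Finset.univ.erase i, |x j - y j| = 1 := by
      rw [Finset.add_sum_erase _ (fun j => |x j - y j|) (Finset.mem_univ i)]
      exact h
    have h2 : 0 ≤ ∑ j ∈ Finset.univ.erase i, |x j - y j| := Finset.sum_nonneg fun _ _ => abs_nonneg _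
    have h3 : 0 < |x i - y i| := abs_pos.mpr (sub_ne_zero.mpr hi)
    have h4 : ∑ j ∈ Finset.univ.erase i, |x j - y j| = 0 := by omega
    have h5 : |x i - y i| = 1 := by omega
    rw [Finset.sum_eq_zero_iff_of_nonneg fun _ _ => abs_nonneg _] at h4
    have h6 : ∀ j, j ≠ i → x j = y j := fun j hj => by
      have := h4 j (by simp [hj])
      rwa [abs_eq_zero, sub_eq_zero] at this
    refine ⟨i, ?_⟩
    rcases (abs_eq (by norm_num)).mp h5 with h7 | h7
    · right
      ext j
      by_cases hj : j = i
      · subst hj; simp [unitVec]; omega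
      · simp [unitVec, hj, h6 j hj]
    · left
      ext j
      by_cases hj : j = i
      · subst hj; simp [unitVec]; omega
      · simp [unitVec, hj, h6 j hj]
  · rintro ⟨i, rfl | rfl⟩
    · rw [adj, Finset.sum_eq_single_of_mem i (Finset.mem_univ i)]
      · simp [unitVec]
      · intro j _ hj; simp [unitVec, hj]
    · rw [adj, Finset.sum_eq_single_of_mem i (Finset.mem_univ i)]
      · simp [unitVec]
      · intro j _ hj; simp [unitVec, hj]

theorem unitVec_injective {d : ℕ} : Function.Injective (unitVec : Fin d → Zd d) := by
  intro i j h
  by_contra hij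
  have := congrFun h i
  simp [unitVec, hij] at this

theorem unitVec_ne_neg {d : ℕ} (i j : Fin d) : (unitVec i : Zd d) ≠ -unitVec j := by
  intro h
  have := congrFun h i
  by_cases hij : i = j
  · subst hij; simp [unitVec] at this
  · simp [unitVec, hij] at this

theorem sum_neighbours_ite {d : ℕ} {x y : Zd d} (h : adj x y) (c : ENNReal) :
    ∑ i, ((if x + unitVec i = y then c else 0) + (if x - unitVec i = y then c else 0)) = c := by
  rw [adj_iff] at h
  obtain ⟨j, rfl | rfl⟩ := h
  · have h1 : ∀ i, x - unitVec i ≠ x + (unitVec j : Zd d) := fun i hi => by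
      rw [sub_eq_add_neg, add_right_inj] at hi
      exact unitVec_ne_neg _ _ hi.symm
    simp [h1, unitVec_injective.eq_iff]
  · have h1 : ∀ i, x + unitVec i ≠ x - (unitVec j : Zd d) := fun i hi => by
      rw [sub_eq_add_neg, add_right_inj] at hi
      exact unitVec_ne_neg _ _ hi
    simp [h1, unitVec_injective.eq_iff]

/-- The set of paths that agree with `w` up to time `n`. -/
def cyl {d : ℕ} (n : ℕ) (w : ℕ → Zd d) : Set (ℕ → Zd d) := {ω | ∀ k ≤ n, ω k = w k}

theorem measurableSet_eval {d : ℕ} (n : ℕ) (A : Set (Zd d)) :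
    MeasurableSet {ω : ℕ → Zd d | ω n ∈ A} :=
  measurable_pi_apply n A.to_countable.measurableSet

theorem measurableSet_eval_eq {d : ℕ} (n : ℕ) (x : Zd d) :
    MeasurableSet {ω : ℕ → Zd d | ω n = x} := measurableSet_eval n {x}

theorem measurableSet_cyl {d : ℕ} (n : ℕ) (w : ℕ → Zd d) : MeasurableSet (cyl n w) := by
  have : cyl n w = ⋂ k, ⋂ _ : k ≤ n, {ω | ω k = w k} := by ext; simp [cyl]
  rw [this]
  exact MeasurableSet.iInter fun k => MeasurableSet.iInter fun _ => measurableSet_eval_eq _ _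

theorem isPiSystem_cyl {d : ℕ} :
    IsPiSystem (Set.range fun p : ℕ × (ℕ → Zd d) => cyl p.1 p.2) := by
  have key : ∀ m n (v w : ℕ → Zd d), m ≤ n → (cyl m v ∩ cyl n w).Nonempty →
      cyl m v ∩ cyl n w = cyl n w := by
    intro m n v w hmn ⟨ω, h1, h2⟩
    refine Set.inter_eq_right.mpr fun η hη k hk => ?_
    rw [hη k (hk.trans hmn), ← h2 k (hk.trans hmn), h1 k hk]
  rintro _ ⟨⟨m, v⟩, rfl⟩ _ ⟨⟨n, w⟩, rfl⟩ hne
  rcases le_total m n with h | h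
  · exact ⟨(n, w), (key m n v w h hne).symm⟩
  · refine ⟨(m, v), ?_⟩
    dsimp only at hne ⊢
    rw [Set.inter_comm] at hne ⊢
    exact (key n m w v h hne).symm

theorem generateFrom_cyl {d : ℕ} : (MeasurableSpace.pi : MeasurableSpace (ℕ → Zd d)) =
    MeasurableSpace.generateFrom (Set.range fun p : ℕ × (ℕ → Zd d) => cyl p.1 p.2) := by
  refine le_antisymm ?_ (MeasurableSpace.generateFrom_le ?_)
  · refine iSup_le fun k => ?_
    rw [← measurable_iff_comap_le]
    refine @measurable_to_countable' _ _ _ _ (_) _ fun z => ?_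
    have : (fun ω : ℕ → Zd d => ω k) ⁻¹' {z} =
        ⋃ v : {v : Fin (k + 1) → Zd d // v (Fin.last k) = z},
          cyl k (fun j => if h : j < k + 1 then v.1 ⟨j, h⟩ else 0) := by
      ext ω
      simp only [Set.mem_preimage, Set.mem_singleton_iff, Set.mem_iUnion, cyl, Set.mem_ofPred_eq]
      constructor
      · intro h
        refine ⟨⟨fun j => ω j, by simpa using h⟩, fun j hj => ?_⟩
        rw [dif_pos (by omega)]
      · rintro ⟨⟨v, hv⟩, h⟩
        rw [h k le_rfl, dif_pos (by omega)]
        exact hv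
    rw [this]
    refine @MeasurableSet.iUnion _ _ (_) _ _ fun v => ?_
    exact MeasurableSpace.measurableSet_generateFrom ⟨(_, _), rfl⟩
  · rintro _ ⟨⟨n, w⟩, rfl⟩
    exact measurableSet_cyl n w

theorem measurable_shift {d : ℕ} :
    Measurable fun (ω : ℕ → Zd d) (n : ℕ) => ω (n + 1) :=
  measurable_pi_lambda _ fun n => measurable_pi_apply (n + 1)

namespace IsSRW

variable {d : ℕ} {P : Zd d → Measure (ℕ → Zd d)}

theorem start_ae (hP : IsSRW d P) (x : Zd d) : ∀ᵐ ω ∂(P x), ω 0 = x := by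
  have := hP.1 x
  have h := hP.2.1 x 0 (fun _ => x) (by simp)
  rw [pow_zero] at h
  have h1 : P x {ω | ω 0 = x} = 1 := by
    rw [← h]
    congr 1
    ext ω
    simp
  exact (mem_ae_iff_prob_eq_one (measurableSet_eval_eq 0 x)).mpr h1

theorem cyl_eq (hP : IsSRW d P) (n : ℕ) (w : ℕ → Zd d) (y : Zd d) :
    P y (cyl n w) = if y = w 0 then P (w 0) (cyl n w) else 0 := by
  split_ifs with h
  · rw [← h]
  · exact hP.2.2 y n w fun hc => h hc.1.symm

theorem map_shift (hd : 0 < d) (hP : IsSRW d P) (x : Zd d) :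
    (P x).map (fun ω n => ω (n + 1)) =
      (2 * d : ENNReal)⁻¹ • ∑ i, (P (x + unitVec i) + P (x - unitVec i)) := by
  have hprob := hP.1
  have hfin : IsProbabilityMeasure ((P x).map (fun ω n => ω (n + 1))) :=
    Measure.isProbabilityMeasure_map measurable_shift.aemeasurable
  refine ext_of_generate_finite _ generateFrom_cyl isPiSystem_cyl ?_ ?_
  · rintro _ ⟨⟨n, w⟩, rfl⟩
    dsimp only
    rw [Measure.map_apply measurable_shift (measurableSet_cyl n w)]
    have e1 : P x ((fun (ω : ℕ → Zd d) (n : ℕ) => ω (n + 1)) ⁻¹' cyl n w) =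
        P x {ω | ∀ k ≤ n + 1, ω k = (fun k => Nat.casesOn k x w : ℕ → Zd d) k} := by
      refine measure_congr ?_
      filter_upwards [hP.start_ae x] with ω hω
      refine propext ⟨fun h k hk => ?_, fun h k hk => h (k + 1) (by omega)⟩
      cases k with
      | zero => exact hω
      | succ k => exact h k (by omega)
    have e2 : ((2 * d : ENNReal)⁻¹ • ∑ i, (P (x + unitVec i) + P (x - unitVec i))) (cyl n w) =
        (2 * d : ENNReal)⁻¹ * ∑ i, ((if x + unitVec i = w 0 then P (w 0) (cyl n w) else 0) +
          (if x - unitVec i = w 0 then P (w 0) (cyl n w) else 0)) := by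
      simp only [Measure.smul_apply, Measure.finsetSum_apply, Measure.add_apply, smul_eq_mul]
      congr 1
      refine Finset.sum_congr rfl fun i _ => ?_
      rw [hP.cyl_eq n w (x + unitVec i), hP.cyl_eq n w (x - unitVec i)]
    rw [e1, e2]
    by_cases hadj : adj x (w 0)
    · rw [sum_neighbours_ite hadj]
      by_cases hw : ∀ k < n, adj (w k) (w (k + 1))
      · rw [hP.2.1 x (n + 1) _ ⟨rfl, fun k hk => ?_⟩, cyl, hP.2.1 (w 0) n w ⟨rfl, hw⟩, pow_succ']
        cases k with
        | zero => exact hadj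
        | succ k => exact hw k (by omega)
      · rw [hP.2.2 x (n + 1), cyl, hP.2.2 (w 0) n w fun h => hw h.2, mul_zero]
        rintro ⟨-, h⟩
        exact hw fun k hk => h (k + 1) (by omega)
    · rw [hP.2.2 x (n + 1) _ fun h => hadj (h.2 0 (by omega)), Finset.sum_eq_zero, mul_zero]
      intro i _
      rw [adj_iff] at hadj
      push Not at hadj
      rw [if_neg (hadj i).1.symm, if_neg (hadj i).2.symm, add_zero]
  · rw [measure_univ]
    simp only [Measure.smul_apply, Measure.finsetSum_apply, Measure.add_apply, measure_univ,
      smul_eq_mul]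
    have : (d : ENNReal) ≠ 0 := by exact_mod_cast hd.ne'
    rw [Finset.sum_const, Finset.card_univ, Fintype.card_fin, nsmul_eq_mul, one_add_one_eq_two,
      mul_comm (d : ENNReal), ENNReal.inv_mul_cancel (by simp [this]) (by finiteness)]

/-- The Markov property at time one. -/
theorem real_shift (hd : 0 < d) (hP : IsSRW d P) (x : Zd d) {B : Set (ℕ → Zd d)}
    (hB : MeasurableSet B) :
    (P x).real {ω | (fun n => ω (n + 1)) ∈ B} = avg d (fun y => (P y).real B) x := by
  have hprob := hP.1
  have h := congrArg (fun μ : Measure (ℕ → Zd d) => (μ B).toReal) (hP.map_shift hd x)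
  simp only [Measure.map_apply measurable_shift hB] at h
  rw [Measure.real]
  refine Eq.trans h ?_
  simp only [Measure.smul_apply, Measure.finsetSum_apply, Measure.add_apply, smul_eq_mul,
    avg_apply]
  rw [ENNReal.toReal_mul, ENNReal.toReal_sum (by finiteness)]
  simp [ENNReal.toReal_add, Measure.real]

theorem real_congr_start (hP : IsSRW d P) (x : Zd d) {A B : Set (ℕ → Zd d)}
    (h : ∀ ω, ω 0 = x → (ω ∈ A ↔ ω ∈ B)) : (P x).real A = (P x).real B := by
  refine measureReal_congr ?_
  filter_upwards [hP.start_ae x] with ω hω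
  exact propext (h ω hω)

/-- The last visit of `K` takes place at time `n` at the point `x`. -/
def _root_.RI.lastVisit (K : Set (Zd d)) (x : Zd d) (n : ℕ) : Set (ℕ → Zd d) :=
  {ω | ω n = x ∧ ∀ m, n < m → ω m ∉ K}

theorem _root_.RI.measurableSet_lastVisit (K : Set (Zd d)) (x : Zd d) (n : ℕ) :
    MeasurableSet (lastVisit K x n) := by
  have : lastVisit K x n = {ω | ω n = x} ∩ ⋂ m, ⋂ _ : n < m, {ω | ω m ∈ K}ᶜ := by
    ext; simp [lastVisit]
  rw [this]
  exact (measurableSet_eval_eq n x).inter (MeasurableSet.iInter fun m =>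
    MeasurableSet.iInter fun _ => (measurableSet_eval m K).compl)

theorem real_lastVisit (hd : 0 < d) (hP : IsSRW d P) (K : Set (Zd d)) (x y : Zd d) (n : ℕ) :
    (P y).real (lastVisit K x n) =
      heat n (y - x) * (P x).real {ω | ∀ n, 1 ≤ n → ω n ∉ K} := by
  have h0 : (fun y => (P y).real (lastVisit K x 0)) =
      (P x).real {ω | ∀ n, 1 ≤ n → ω n ∉ K} • fun y => if y = x then (1 : ℝ) else 0 := by
    ext y
    rw [Pi.smul_apply, smul_eq_mul]
    split_ifs with h
    · subst h
      rw [mul_one]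
      refine hP.real_congr_start _ fun ω hω => ?_
      simp only [lastVisit, Set.mem_ofPred_eq, hω, true_and]
      rfl
    · rw [mul_zero, ← measureReal_empty (μ := P y)]
      refine hP.real_congr_start _ fun ω hω => ?_
      simp [lastVisit, hω, h]
  have h1 : ∀ n, (fun y => (P y).real (lastVisit K x n)) =
      (avg d ^ n) (fun y => (P y).real (lastVisit K x 0)) := by
    intro n
    induction n with
    | zero => rfl
    | succ n ih =>
      rw [avg_pow_succ, ← ih]
      ext y
      rw [← hP.real_shift hd y (measurableSet_lastVisit K x n)]
      congr 1
      ext ω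
      simp only [lastVisit, Set.mem_ofPred_eq, and_congr_right_iff]
      intro _
      constructor
      · intro h m hm
        exact h (m + 1) (by omega)
      · intro h m hm
        obtain ⟨k, rfl⟩ : ∃ k, m = k + 1 := ⟨m - 1, by omega⟩
        exact h k (by omega)
  have h2 := congrFun (h1 n) y
  rw [h0, map_smul, Pi.smul_apply, avg_pow_single] at h2
  rw [h2, smul_eq_mul, mul_comm]

theorem real_eval (hd : 0 < d) (hP : IsSRW d P) (x y : Zd d) (n : ℕ) :
    (P y).real {ω | ω n = x} = heat n (y - x) := by
  have hprob := hP.1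
  have := hP.real_lastVisit hd ∅ x y n
  simpa [lastVisit] using this

/-- The walk is transient. -/
theorem ae_finite_visits (hd : 3 ≤ d) (hP : IsSRW d P) (y : Zd d) (K : Finset (Zd d)) :
    ∀ᵐ ω ∂(P y), ∀ᶠ n in atTop, ω n ∉ K := by
  have hprob := hP.1
  have h : ∀ x ∈ K, ∀ᵐ ω ∂(P y), ∀ᶠ n in atTop, ω n ≠ x := by
    intro x _
    have h1 : ∑' n, P y {ω | ω n = x} ≠ ⊤ := by
      have : ∀ n, P y {ω | ω n = x} = ENNReal.ofReal (heat n (y - x)) := fun n => by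
        rw [← hP.real_eval (by omega), ofReal_measureReal]
      simp only [this]
      rw [← ENNReal.ofReal_tsum_of_nonneg (fun n => heat_nonneg n _) (summable_heat hd _)]
      exact ENNReal.ofReal_ne_top
    exact ae_eventually_notMem h1
  rw [← Finset.eventually_all] at h
  filter_upwards [h] with ω hω
  rw [← Finset.eventually_all] at hω
  filter_upwards [hω] with n hn hK
  exact hn _ hK rfl

/-- The last exit decomposition. -/
theorem real_hit (hd : 3 ≤ d) (hP : IsSRW d P) (y : Zd d) (K : Finset (Zd d)) :
    (P y).real {ω | ∃ n, ω n ∈ K} = ∑ x ∈ K, green (y - x) * eqm P K x := by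
  have hprob := hP.1
  have h1 : (P y).real {ω | ∃ n, ω n ∈ K} = (P y).real (⋃ n, ⋃ x ∈ K, lastVisit ↑K x n) := by
    refine measureReal_congr ?_
    filter_upwards [hP.ae_finite_visits hd y K] with ω hω
    refine propext ⟨fun ⟨n, hn⟩ => ?_, fun h => ?_⟩
    · obtain ⟨N, hN⟩ := eventually_atTop.mp hω
      classical
      have hbd : ∀ m, ω m ∈ K → m ≤ N := fun m hm => by
        by_contra hc
        exact hN m (by omega) hm
      have hs := Nat.findGreatest_spec (P := fun m => ω m ∈ K) (hbd n hn) hn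
      refine Set.mem_iUnion.mpr ⟨_, Set.mem_iUnion₂.mpr ⟨_, hs, rfl, fun m hm hmK => ?_⟩⟩
      exact Nat.findGreatest_is_greatest hm (hbd m hmK) hmK
    · obtain ⟨n, hn⟩ := Set.mem_iUnion.mp h
      obtain ⟨x, hx, hxn, -⟩ := Set.mem_iUnion₂.mp hn
      exact ⟨n, hxn ▸ hx⟩
  have hterm : ∀ n, (P y).real (⋃ x ∈ K, lastVisit ↑K x n) =
      ∑ x ∈ K, heat n (y - x) * eqm P K x := by
    intro n
    rw [measureReal_biUnion_finset]
    · refine Finset.sum_congr rfl fun x hx => ?_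
      rw [hP.real_lastVisit (by omega), eqm, Set.indicator_of_mem (by exact_mod_cast hx)]
      rfl
    · intro x _ x' _ hxx'
      refine Set.disjoint_left.mpr fun ω h h' => hxx' (h.1.symm.trans h'.1)
    · exact fun x _ => measurableSet_lastVisit _ x n
  have hdisj : Pairwise (Function.onFun Disjoint fun n => ⋃ x ∈ K, lastVisit (↑K : Set (Zd d)) x n) := by
    have key : ∀ m n, m < n → Disjoint (⋃ x ∈ K, lastVisit (↑K : Set (Zd d)) x m)
        (⋃ x ∈ K, lastVisit (↑K : Set (Zd d)) x n) := by
      intro m n hmn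
      refine Set.disjoint_left.mpr fun ω h h' => ?_
      obtain ⟨x, hx, -, hx2⟩ := Set.mem_iUnion₂.mp h
      obtain ⟨x', hx', hx'1, -⟩ := Set.mem_iUnion₂.mp h'
      exact hx2 n hmn (hx'1 ▸ hx')
    intro m n hmn
    rcases lt_or_gt_of_ne hmn with h | h
    · exact key m n h
    · exact (key n m h).symm
  rw [h1, Measure.real, measure_iUnion hdisj fun n =>
    K.measurableSet_biUnion fun x _ => measurableSet_lastVisit _ x n,
    ENNReal.tsum_toReal_eq fun n => measure_ne_top _ _]
  have h2 : HasSum (fun n => (P y).real (⋃ x ∈ K, lastVisit (↑K : Set (Zd d)) x n))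
      (∑ x ∈ K, green (y - x) * eqm P K x) := by
    simp only [hterm]
    exact hasSum_sum fun x _ => (summable_heat hd _).hasSum.mul_right _
  exact h2.tsum_eq

end IsSRW

theorem eqm_nonneg {d : ℕ} (P : Zd d → Measure (ℕ → Zd d)) (K : Set (Zd d)) (x : Zd d) :
    0 ≤ eqm P K x := Set.indicator_nonneg (fun _ _ => ENNReal.toReal_nonneg) x

theorem green_sub_comm {d : ℕ} (x y : Zd d) : green (x - y) = green (y - x) := by
  rw [← green_neg, neg_sub]

open Classical in
/-- The indices of the sets visited up to time `n`. -/
noncomputable def visitedUpTo {d : ℕ} {ι : Type*} [Fintype ι] (K : ι → Finset (Zd d)) (n : ℕ)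
    (ω : ℕ → Zd d) : Finset ι := {i | ∃ m ≤ n, ω m ∈ K i}

open Classical in
/-- The indices of the sets visited by a path. -/
noncomputable def visited {d : ℕ} {ι : Type*} [Fintype ι] (K : ι → Finset (Zd d))
    (ω : ℕ → Zd d) : Finset ι := {i | ∃ m, ω m ∈ K i}

section

variable {d : ℕ} {ι : Type*} [Fintype ι] {K : ι → Finset (Zd d)}

theorem mem_visitedUpTo {n : ℕ} {ω : ℕ → Zd d} {i : ι} :
    i ∈ visitedUpTo K n ω ↔ ∃ m ≤ n, ω m ∈ K i := by
  simp [visitedUpTo]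

theorem mem_visited {ω : ℕ → Zd d} {i : ι} : i ∈ visited K ω ↔ ∃ m, ω m ∈ K i := by
  simp [visited]

theorem eventually_visitedUpTo_eq (K : ι → Finset (Zd d)) (ω : ℕ → Zd d) :
    ∀ᶠ n in atTop, visitedUpTo K n ω = visited K ω := by
  have h : ∀ i, ∀ᶠ n in atTop, (i ∈ visitedUpTo K n ω ↔ i ∈ visited K ω) := by
    intro i
    by_cases hi : i ∈ visited K ω
    · obtain ⟨m, hm⟩ := mem_visited.mp hi
      filter_upwards [eventually_ge_atTop m] with n hn
      exact iff_of_true (mem_visitedUpTo.mpr ⟨m, hn, hm⟩) hi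
    · refine Eventually.of_forall fun n => iff_of_false (fun h => hi ?_) hi
      obtain ⟨m, -, hm⟩ := mem_visitedUpTo.mp h
      exact mem_visited.mpr ⟨m, hm⟩
  filter_upwards [eventually_all.mpr h] with n hn
  exact Finset.ext hn

theorem measurableSet_visitedUpTo_mem (K : ι → Finset (Zd d)) (n : ℕ) (𝒯 : Set (Finset ι)) :
    MeasurableSet {ω | visitedUpTo K n ω ∈ 𝒯} := by
  have h : ∀ i, MeasurableSet {ω | i ∈ visitedUpTo K n ω} := by
    intro i
    have : {ω | i ∈ visitedUpTo K n ω} = ⋃ m, ⋃ _ : m ≤ n, {ω | ω m ∈ (K i : Set (Zd d))} := by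
      ext ω; simp [mem_visitedUpTo]
    rw [this]
    exact MeasurableSet.iUnion fun m => MeasurableSet.iUnion fun _ => measurableSet_eval m _
  have h1 : ∀ T, MeasurableSet {ω | visitedUpTo K n ω = T} := by
    intro T
    have : {ω | visitedUpTo K n ω = T} =
        (⋂ i, ⋂ _ : i ∈ T, {ω | i ∈ visitedUpTo K n ω}) ∩
          ⋂ i, ⋂ _ : i ∉ T, {ω | i ∈ visitedUpTo K n ω}ᶜ := by
      ext ω
      simp only [Set.mem_ofPred_eq, Set.mem_inter_iff, Set.mem_iInter, Set.mem_compl_iff]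
      constructor
      · rintro rfl
        exact ⟨fun _ h => h, fun _ h => h⟩
      · rintro ⟨h1, h2⟩
        exact Finset.ext fun i => ⟨fun hi => by_contra fun hc => h2 i hc hi, h1 i⟩
    rw [this]
    exact (MeasurableSet.iInter fun i => MeasurableSet.iInter fun _ => h i).inter
      (MeasurableSet.iInter fun i => MeasurableSet.iInter fun _ => (h i).compl)
  have : {ω | visitedUpTo K n ω ∈ 𝒯} = ⋃ T ∈ 𝒯, {ω | visitedUpTo K n ω = T} := by
    ext ω; simp
  rw [this]
  exact MeasurableSet.biUnion 𝒯.to_countable fun T _ => h1 T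

theorem measurableSet_visited_mem (K : ι → Finset (Zd d)) (𝒯 : Set (Finset ι)) :
    MeasurableSet {ω | visited K ω ∈ 𝒯} := by
  refine measurableSet_of_tendsto_indicator (L := atTop)
    (As := fun n => {ω | visitedUpTo K n ω ∈ 𝒯}) (fun n => measurableSet_visitedUpTo_mem K n 𝒯) ?_
  intro ω
  filter_upwards [eventually_visitedUpTo_eq K ω] with n hn
  simp [hn]

end

namespace IsSRW

variable {d : ℕ} {P : Zd d → Measure (ℕ → Zd d)}

theorem sum_green_mul_eqm_le (hd : 3 ≤ d) (hP : IsSRW d P) (y : Zd d) (K : Finset (Zd d)) :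
    ∑ x ∈ K, eqm P K x * green (x - y) ≤ 1 := by
  have hprob := hP.1
  calc _ = (P y).real {ω | ∃ n, ω n ∈ K} := by
        rw [hP.real_hit hd]
        exact Finset.sum_congr rfl fun x _ => by rw [green_sub_comm, mul_comm]
    _ ≤ 1 := measureReal_le_one

/-- The sweeping identity. -/
theorem capa_eq_sum (hd : 3 ≤ d) (hP : IsSRW d P) {A K : Finset (Zd d)} (hAK : A ⊆ K) :
    capa P A = ∑ x ∈ K, eqm P K x * (P x).real {ω | ∃ n, ω n ∈ A} := by
  have hprob := hP.1
  have h : ∀ y ∈ A, eqm P A y = ∑ x ∈ K, eqm P A y * (green (y - x) * eqm P K x) := by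
    intro y hy
    rw [← Finset.mul_sum, ← hP.real_hit hd,
      hP.real_congr_start y (A := {ω | ∃ n, ω n ∈ K}) (B := Set.univ) fun ω hω =>
        iff_of_true ⟨0, hω ▸ hAK hy⟩ trivial, probReal_univ, mul_one]
  rw [capa, Finset.sum_congr rfl h, Finset.sum_comm]
  refine Finset.sum_congr rfl fun x _ => ?_
  rw [hP.real_hit hd, Finset.mul_sum]
  exact Finset.sum_congr rfl fun y _ => by rw [green_sub_comm]; ring

variable {ι : Type*} [Fintype ι] [DecidableEq ι] {K : ι → Finset (Zd d)}

theorem sum_real_visitedUpTo_le (hd : 0 < d) (hP : IsSRW d P) {U : ι → Zd d → ℝ} {l : ℝ}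
    (hl : 1 ≤ l) (hU : ∀ i, 0 ≤ U i) (hsuper : ∀ i, avg d (U i) ≤ U i)
    (hone : ∀ i, ∀ x ∈ K i, 1 ≤ U i x)
    (hsmall : ∀ i, ∀ x ∈ K i, 2 * l * ∑ j ∈ Finset.univ.erase i, U j x ≤ 1)
    (hdisj : ∀ i j, i ≠ j → Disjoint (K i) (K j)) (n : ℕ) (x : Zd d) (A : Finset ι) :
    ∑ B, l ^ B.card * (P x).real {ω | A ∪ visitedUpTo K n ω = B} ≤
      l ^ A.card * (1 + 2 * l * ∑ i ∈ Finset.univ \ A, U i x) := by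
  classical
  have hprob := hP.1
  have hl0 : 0 < l := by linarith
  set J : Zd d → Finset ι := fun x => {i | x ∈ K i} with hJ
  have hpow : ∀ (A : Finset ι) (x : Zd d),
      l ^ A.card ≤ l ^ A.card * (1 + 2 * l * ∑ i ∈ Finset.univ \ A, U i x) := by
    intro A x
    have : 0 ≤ ∑ i ∈ Finset.univ \ A, U i x := Finset.sum_nonneg fun i _ => hU i x
    exact le_mul_of_one_le_right (by positivity) (by nlinarith)
  have hjump : ∀ (A : Finset ι) (x : Zd d),
      l ^ (A ∪ J x).card * (1 + 2 * l * ∑ i ∈ Finset.univ \ (A ∪ J x), U i x) ≤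
        l ^ A.card * (1 + 2 * l * ∑ i ∈ Finset.univ \ A, U i x) := by
    intro A x
    by_cases hsub : J x ⊆ A
    · rw [Finset.union_eq_left.mpr hsub]
    · obtain ⟨j, hj, hjA⟩ := Finset.not_subset.mp hsub
      have hxj : x ∈ K j := by simpa [hJ] using hj
      have hJx : J x = {j} := by
        ext i
        simp only [hJ, Finset.mem_filter, Finset.mem_univ, true_and, Finset.mem_singleton]
        constructor
        · intro hi
          by_contra hne
          exact Finset.disjoint_left.mp (hdisj i j hne) hi hxj
        · rintro rfl; exact hxj
      have hcard : (A ∪ J x).card = A.card + 1 := by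
        rw [hJx, Finset.union_comm, ← Finset.insert_eq, Finset.card_insert_of_notMem hjA]
      have h1 : ∑ i ∈ Finset.univ \ (A ∪ J x), U i x ≤ ∑ i ∈ Finset.univ.erase j, U i x := by
        refine Finset.sum_le_sum_of_subset_of_nonneg (fun i hi => ?_) fun i _ _ => hU i x
        rw [hJx] at hi
        simp at hi
        simp [hi]
      have h2 : 1 ≤ ∑ i ∈ Finset.univ \ A, U i x :=
        (hone j x hxj).trans (Finset.single_le_sum (f := fun i => U i x) (fun i _ => hU i x)
          (by simpa using hjA))
      have h3 := hsmall j x hxj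
      rw [hcard, pow_succ, mul_assoc]
      refine mul_le_mul_of_nonneg_left ?_ (by positivity)
      have h4 : 2 * l * ∑ i ∈ Finset.univ \ (A ∪ J x), U i x ≤ 1 :=
        (mul_le_mul_of_nonneg_left h1 (by positivity)).trans h3
      nlinarith
  induction n generalizing x A with
  | zero =>
    have h0 : ∀ B, (P x).real {ω | A ∪ visitedUpTo K 0 ω = B} = if A ∪ J x = B then 1 else 0 := by
      intro B
      have hv : ∀ ω : ℕ → Zd d, ω 0 = x → visitedUpTo K 0 ω = J x := by
        intro ω hω
        ext i
        simp [mem_visitedUpTo, hJ, hω]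
      split_ifs with h
      · rw [← probReal_univ (μ := P x)]
        refine hP.real_congr_start x fun ω hω => ?_
        simp [hv ω hω, h]
      · rw [← measureReal_empty (μ := P x)]
        refine hP.real_congr_start x fun ω hω => ?_
        simp [hv ω hω, h]
    simp only [h0, mul_ite, mul_one, mul_zero, Finset.sum_ite_eq, Finset.mem_univ, if_true]
    exact (hpow _ x).trans (hjump A x)
  | succ n ih =>
    have hstep : ∀ B, (P x).real {ω | A ∪ visitedUpTo K (n + 1) ω = B} =
        avg d (fun y => (P y).real {ω | (A ∪ J x) ∪ visitedUpTo K n ω = B}) x := by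
      intro B
      refine Eq.trans ?_
        (hP.real_shift hd x (measurableSet_visitedUpTo_mem K n {T | (A ∪ J x) ∪ T = B}))
      refine hP.real_congr_start x fun ω hω => ?_
      have : visitedUpTo K (n + 1) ω = J x ∪ visitedUpTo K n (fun m => ω (m + 1)) := by
        ext i
        simp only [Finset.mem_union, mem_visitedUpTo, hJ, Finset.mem_filter, Finset.mem_univ,
          true_and]
        constructor
        · rintro ⟨m, hm, hmi⟩
          cases m with
          | zero => left; rwa [hω] at hmi
          | succ m => right; exact ⟨m, by omega, hmi⟩
        · rintro (h | ⟨m, hm, hmi⟩)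
          · exact ⟨0, by omega, by rwa [hω]⟩
          · exact ⟨m + 1, by omega, hmi⟩
      simp only [Set.mem_ofPred_eq, this, Finset.union_assoc]
    simp only [hstep]
    have e : ∑ B, l ^ B.card * avg d (fun y => (P y).real {ω | (A ∪ J x) ∪ visitedUpTo K n ω = B}) x =
        avg d (fun y => ∑ B, l ^ B.card * (P y).real {ω | (A ∪ J x) ∪ visitedUpTo K n ω = B}) x := by
      have : (fun y => ∑ B : Finset ι, l ^ B.card *
          (P y).real {ω | (A ∪ J x) ∪ visitedUpTo K n ω = B}) =
          ∑ B : Finset ι, l ^ B.card •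
            fun y => (P y).real {ω | (A ∪ J x) ∪ visitedUpTo K n ω = B} := by
        ext y; simp [Finset.sum_apply]
      rw [this, map_sum, Finset.sum_apply]
      exact Finset.sum_congr rfl fun B _ => by rw [map_smul]; rfl
    rw [e]
    refine le_trans (avg_mono (fun y => ih y (A ∪ J x)) x) ?_
    refine le_trans ?_ (hjump A x)
    have e2 : (fun y => l ^ (A ∪ J x).card * (1 + 2 * l * ∑ i ∈ Finset.univ \ (A ∪ J x), U i y)) =
        l ^ (A ∪ J x).card • ((fun _ => 1) + (2 * l) • ∑ i ∈ Finset.univ \ (A ∪ J x), U i) := by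
      ext y; simp [Finset.sum_apply]
    rw [e2, map_smul, map_add, map_smul, map_sum, avg_const hd]
    simp only [Pi.smul_apply, Pi.add_apply, smul_eq_mul, Finset.sum_apply]
    gcongr with i hi
    exact hsuper i x

theorem sum_real_visited_le (hd : 0 < d) (hP : IsSRW d P) {U : ι → Zd d → ℝ} {l : ℝ}
    (hl : 1 ≤ l) (hU : ∀ i, 0 ≤ U i) (hsuper : ∀ i, avg d (U i) ≤ U i)
    (hone : ∀ i, ∀ x ∈ K i, 1 ≤ U i x)
    (hsmall : ∀ i, ∀ x ∈ K i, 2 * l * ∑ j ∈ Finset.univ.erase i, U j x ≤ 1)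
    (hdisj : ∀ i j, i ≠ j → Disjoint (K i) (K j)) (x : Zd d) :
    ∑ B, l ^ B.card * (P x).real {ω | visited K ω = B} ≤ 1 + 2 * l * ∑ i, U i x := by
  have hprob := hP.1
  have hlim : ∀ B : Finset ι, Tendsto (fun n => (P x).real {ω | ∅ ∪ visitedUpTo K n ω = B}) atTop
      (nhds ((P x).real {ω | visited K ω = B})) := by
    intro B
    refine (ENNReal.tendsto_toReal (measure_ne_top _ _)).comp ?_
    simp only [Finset.empty_union]
    refine tendsto_measure_of_tendsto_indicator_of_isFiniteMeasure atTop (P x)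
      (fun n => measurableSet_visitedUpTo_mem K n {B}) ?_
    intro ω
    filter_upwards [eventually_visitedUpTo_eq K ω] with n hn
    simp [hn]
  refine le_of_tendsto (tendsto_finsetSum _ fun B _ => (hlim B).const_mul _)
    (Eventually.of_forall fun n => ?_)
  simpa using hP.sum_real_visitedUpTo_le hd hl hU hsuper hone hsmall hdisj n x ∅

end IsSRW

theorem sum_neg_one_pow_mul_prod_disjoint_le {ι : Type*} [Fintype ι] [DecidableEq ι] {l : ℝ}
    (hl : 1 ≤ l) (𝓑 : Finset (Finset ι)) :
    ∑ S : Finset ι, (-1 : ℝ) ^ S.card * ∏ T ∈ 𝓑, (if Disjoint T S then (1 : ℝ) else 0)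
      ≤ (l ^ Fintype.card ι)⁻¹ * ∏ T ∈ 𝓑, l ^ T.card := by
  have hl0 : 0 < l := by linarith
  have h1 : ∀ S : Finset ι, (-1 : ℝ) ^ S.card * ∏ T ∈ 𝓑, (if Disjoint T S then (1 : ℝ) else 0)
      = if S ∈ ((𝓑.biUnion id)ᶜ).powerset then (-1 : ℝ) ^ S.card else 0 := by
    intro S
    rw [Finset.prod_boole]
    have : (∀ T ∈ 𝓑, Disjoint T S) ↔ S ∈ ((𝓑.biUnion id)ᶜ).powerset := by
      rw [Finset.mem_powerset, Finset.subset_compl_iff_disjoint_left,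
        Finset.disjoint_biUnion_left]
      rfl
    by_cases h : S ∈ ((𝓑.biUnion id)ᶜ).powerset
    · rw [if_pos h, if_pos (this.mpr h), mul_one]
    · rw [if_neg h, if_neg (fun h' => h (this.mp h')), mul_zero]
  rw [Finset.sum_congr rfl fun S _ => h1 S, ← Finset.sum_filter, Finset.filter_mem_eq_inter,
    Finset.univ_inter]
  have h2 := congrArg (Int.cast : ℤ → ℝ)
    (Finset.sum_powerset_neg_one_pow_card (x := (𝓑.biUnion id)ᶜ))
  push_cast at h2
  rw [h2, Finset.prod_pow_eq_pow_sum]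
  split_ifs with hV
  · rw [inv_mul_eq_div, one_le_div (pow_pos hl0 _)]
    refine pow_le_pow_right₀ hl ?_
    rw [← Finset.card_univ, ← (Finset.compl_eq_empty_iff _).mp hV]
    exact Finset.card_biUnion_le
  · positivity

theorem sum_neg_one_pow_mul_exp_le {ι : Type*} [Fintype ι] [DecidableEq ι] {ν : Finset ι → ℝ}
    (hν : ∀ T, 0 ≤ ν T) {u l : ℝ} (hu : 0 ≤ u) (hl : 1 ≤ l) :
    ∑ S : Finset ι, (-1 : ℝ) ^ S.card *
        Real.exp (-(u * ∑ T : Finset ι, if Disjoint T S then 0 else ν T))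
      ≤ (l ^ Fintype.card ι)⁻¹ * Real.exp (u * ∑ T : Finset ι, ν T * (l ^ T.card - 1)) := by
  set p : Finset ι → ℝ := fun T => 1 - Real.exp (-(u * ν T)) with hp
  have hp0 : ∀ T, 0 ≤ p T := fun T => by
    have : Real.exp (-(u * ν T)) ≤ 1 := Real.exp_le_one_iff.mpr (by
      have := mul_nonneg hu (hν T); linarith)
    simp only [hp]; linarith
  have hp1 : ∀ T, 0 ≤ 1 - p T := fun T => by simp only [hp]; linarith [Real.exp_pos (-(u * ν T))]
  have hpu : ∀ T, p T ≤ u * ν T := fun T => by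
    simp only [hp]; linarith [Real.add_one_le_exp (-(u * ν T))]
  have hexp : ∀ S : Finset ι,
      Real.exp (-(u * ∑ T : Finset ι, if Disjoint T S then 0 else ν T))
        = ∑ 𝓑 ∈ (Finset.univ : Finset (Finset ι)).powerset,
          (∏ T ∈ 𝓑, p T * (if Disjoint T S then (1 : ℝ) else 0)) *
            ∏ T ∈ Finset.univ \ 𝓑, (1 - p T) := by
    intro S
    rw [← Finset.prod_add, Finset.mul_sum, ← Finset.sum_neg_distrib, Real.exp_sum]
    refine Finset.prod_congr rfl fun T _ => ?_
    split_ifs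
    · simp
    · simp [hp]
  calc _ = ∑ 𝓑 ∈ (Finset.univ : Finset (Finset ι)).powerset,
        ((∏ T ∈ 𝓑, p T) * ∏ T ∈ Finset.univ \ 𝓑, (1 - p T)) *
          ∑ S : Finset ι, (-1 : ℝ) ^ S.card *
            ∏ T ∈ 𝓑, (if Disjoint T S then (1 : ℝ) else 0) := by
        simp_rw [hexp, Finset.mul_sum]
        rw [Finset.sum_comm]
        refine Finset.sum_congr rfl fun 𝓑 _ => Finset.sum_congr rfl fun S _ => ?_
        rw [Finset.prod_mul_distrib]
        ring
    _ ≤ ∑ 𝓑 ∈ (Finset.univ : Finset (Finset ι)).powerset,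
        ((∏ T ∈ 𝓑, p T) * ∏ T ∈ Finset.univ \ 𝓑, (1 - p T)) *
          ((l ^ Fintype.card ι)⁻¹ * ∏ T ∈ 𝓑, l ^ T.card) := by
        refine Finset.sum_le_sum fun 𝓑 _ => mul_le_mul_of_nonneg_left
          (sum_neg_one_pow_mul_prod_disjoint_le hl 𝓑) ?_
        exact mul_nonneg (Finset.prod_nonneg fun T _ => hp0 T)
          (Finset.prod_nonneg fun T _ => hp1 T)
    _ = (l ^ Fintype.card ι)⁻¹ * ∏ T : Finset ι, (p T * l ^ T.card + (1 - p T)) := by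
        rw [Finset.prod_add, Finset.mul_sum]
        refine Finset.sum_congr rfl fun 𝓑 _ => ?_
        rw [Finset.prod_mul_distrib]
        ring
    _ ≤ _ := by
        refine mul_le_mul_of_nonneg_left ?_ (by positivity)
        rw [Finset.mul_sum, Real.exp_sum]
        refine Finset.prod_le_prod (fun T _ => ?_) fun T _ => ?_
        · have := mul_nonneg (hp0 T) (pow_nonneg (zero_le_one.trans hl) T.card)
          linarith [hp1 T]
        · have h1 : 0 ≤ l ^ T.card - 1 := by linarith [one_le_pow₀ hl (n := T.card)]
          have h2 := mul_le_mul_of_nonneg_right (hpu T) h1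
          have h3 := Real.add_one_le_exp (u * (ν T * (l ^ T.card - 1)))
          linarith

theorem real_forall_exists_false_eq {d : ℕ} {ι : Type*} [Fintype ι] [DecidableEq ι]
    (K : ι → Finset (Zd d)) (Q : Measure (Zd d → Bool)) [IsProbabilityMeasure Q] :
    Q.real {Y | ∀ i, ∃ x ∈ K i, Y x = false} = ∑ S : Finset ι, (-1 : ℝ) ^ S.card *
      Q.real {Y | ∀ x ∈ S.biUnion K, Y x = true} := by
  have hm : ∀ i ∈ (Finset.univ : Finset ι), MeasurableSet {Y : Zd d → Bool | ∀ x ∈ K i, Y x = true} := by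
    intro i _
    have : {Y : Zd d → Bool | ∀ x ∈ K i, Y x = true} = ⋂ x ∈ K i, (fun Y => Y x) ⁻¹' {true} := by
      ext Y; simp
    rw [this]
    exact Finset.measurableSet_biInter _ fun x _ => measurable_pi_apply x (measurableSet_singleton _)
  have h := measureReal_biUnion_eq_sum_powerset (μ := Q) hm
  have hc : {Y : Zd d → Bool | ∀ i, ∃ x ∈ K i, Y x = false} =
      (⋃ i ∈ (Finset.univ : Finset ι), {Y : Zd d → Bool | ∀ x ∈ K i, Y x = true})ᶜ := by
    ext Y; simp
  have hi : ∀ S : Finset ι, ⋂ i ∈ S, {Y : Zd d → Bool | ∀ x ∈ K i, Y x = true} =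
      {Y | ∀ x ∈ S.biUnion K, Y x = true} := by
    intro S; ext Y
    simp only [Set.mem_iInter, Set.mem_ofPred_eq, Finset.mem_biUnion]
    exact ⟨fun h x ⟨i, hi, hx⟩ => h i hi x hx, fun h i hi x hx => h x ⟨i, hi, hx⟩⟩
  rw [hc, probReal_compl_eq_one_sub (Finset.measurableSet_biUnion _ hm), h]
  simp_rw [hi]
  rw [← Finset.sum_filter_add_sum_filter_not Finset.univ (fun S : Finset ι => S.Nonempty),
    Finset.powerset_univ]
  have h0 : (Finset.univ.filter fun S : Finset ι => ¬ S.Nonempty) = {∅} := by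
    ext S; simp
  rw [h0, Finset.sum_singleton]
  simp only [Finset.card_empty, pow_zero, Finset.biUnion_empty, Finset.notMem_empty,
    false_imp_iff, implies_true, Set.ofPred_true, probReal_univ, pow_succ]
  simp only [mul_neg, mul_one, neg_mul, Finset.sum_neg_distrib]
  ring

namespace IsSRW

variable {d : ℕ} {P : Zd d → Measure (ℕ → Zd d)} {ι : Type*} [Fintype ι] [DecidableEq ι]
  {K : ι → Finset (Zd d)}

theorem capa_biUnion_eq_sum (hd : 3 ≤ d) (hP : IsSRW d P) (S : Finset ι) :
    capa P (S.biUnion K) = ∑ T : Finset ι, if Disjoint T S then 0 else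
      ∑ x ∈ Finset.univ.biUnion K, eqm P (Finset.univ.biUnion K : Finset (Zd d)) x *
        (P x).real {ω | visited K ω = T} := by
  have hprob := hP.1
  rw [hP.capa_eq_sum hd (Finset.biUnion_subset_biUnion_of_subset_left K (Finset.subset_univ S))]
  have h : ∀ x, (P x).real {ω | ∃ n, ω n ∈ S.biUnion K} =
      ∑ T : Finset ι, if Disjoint T S then 0 else (P x).real {ω | visited K ω = T} := by
    intro x
    rw [Finset.sum_congr rfl fun T _ => (ite_not (p := Disjoint T S) _ _).symm,
      ← Finset.sum_filter]
    have hset : {ω : ℕ → Zd d | ∃ n, ω n ∈ S.biUnion K} =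
        ⋃ T ∈ Finset.univ.filter fun T : Finset ι => ¬Disjoint T S, {ω | visited K ω = T} := by
      ext ω
      simp only [Set.mem_ofPred_eq, Set.mem_iUnion, Finset.mem_filter, Finset.mem_univ, true_and,
        exists_prop, exists_eq_right', Finset.not_disjoint_iff, mem_visited, Finset.mem_biUnion]
      exact ⟨fun ⟨n, i, hi, hn⟩ => ⟨i, ⟨n, hn⟩, hi⟩, fun ⟨i, ⟨n, hn⟩, hi⟩ => ⟨n, i, hi, hn⟩⟩
    rw [hset, measureReal_biUnion_finset]
    · intro T _ T' _ hTT'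
      exact Set.disjoint_left.mpr fun ω h1 h2 => hTT' (h1.symm.trans h2)
    · exact fun T _ => measurableSet_visited_mem K {T}
  simp_rw [h, Finset.mul_sum]
  rw [Finset.sum_comm]
  refine Finset.sum_congr rfl fun T _ => ?_
  split_ifs <;> simp

theorem real_forall_exists_false_le (hd : 3 ≤ d) (hP : IsSRW d P) {u : ℝ} (hu : 0 ≤ u)
    {Q : Measure (Zd d → Bool)} (hQ : IsVacantLaw P u Q) {U : ι → Zd d → ℝ} {l M : ℝ}
    (hl : 1 ≤ l) (hU : ∀ i, 0 ≤ U i) (hsuper : ∀ i, avg d (U i) ≤ U i)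
    (hone : ∀ i, ∀ x ∈ K i, 1 ≤ U i x)
    (hsmall : ∀ i, ∀ x ∈ K i, 2 * l * ∑ j ∈ Finset.univ.erase i, U j x ≤ 1)
    (hdisj : ∀ i j, i ≠ j → Disjoint (K i) (K j))
    (hM : ∀ i, ∀ A : Finset (Zd d), ∑ x ∈ A, eqm P A x * U i x ≤ M) :
    Q.real {Y | ∀ i, ∃ x ∈ K i, Y x = false} ≤
      (l ^ Fintype.card ι)⁻¹ * Real.exp (u * (2 * l * (Fintype.card ι * M))) := by
  have hprob := hP.1
  have hQp := hQ.1
  set A := Finset.univ.biUnion K with hA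
  set ν : Finset ι → ℝ := fun T => ∑ x ∈ A, eqm P A x * (P x).real {ω | visited K ω = T} with hν
  have hν0 : ∀ T, 0 ≤ ν T := fun T => Finset.sum_nonneg fun x _ =>
    mul_nonneg (eqm_nonneg P A x) measureReal_nonneg
  have htot : ∀ x, ∑ T, (P x).real {ω | visited K ω = T} = 1 := by
    intro x
    rw [← measureReal_biUnion_finset, ← probReal_univ (μ := P x)]
    · congr 1; ext ω; simp
    · intro T _ T' _ hTT'
      exact Set.disjoint_left.mpr fun ω h1 h2 => hTT' (h1.symm.trans h2)
    · exact fun T _ => measurableSet_visited_mem K {T}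
  have hsum : ∑ T, ν T * (l ^ T.card - 1) ≤ 2 * l * (Fintype.card ι * M) := by
    calc _ = ∑ x ∈ A, eqm P A x * ∑ T, (l ^ T.card * (P x).real {ω | visited K ω = T} -
          (P x).real {ω | visited K ω = T}) := by
          simp_rw [hν, Finset.sum_mul, Finset.mul_sum]
          rw [Finset.sum_comm]
          exact Finset.sum_congr rfl fun x _ => Finset.sum_congr rfl fun T _ => by ring
      _ ≤ ∑ x ∈ A, eqm P A x * (2 * l * ∑ i, U i x) := by
          refine Finset.sum_le_sum fun x _ => mul_le_mul_of_nonneg_left ?_ (eqm_nonneg P A x)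
          rw [Finset.sum_sub_distrib, htot]
          linarith [hP.sum_real_visited_le (by omega) hl hU hsuper hone hsmall hdisj x]
      _ = 2 * l * ∑ i, ∑ x ∈ A, eqm P A x * U i x := by
          rw [Finset.sum_comm, Finset.mul_sum]
          refine Finset.sum_congr rfl fun x _ => ?_
          rw [← Finset.mul_sum]
          ring
      _ ≤ 2 * l * ∑ _i : ι, M := by
          gcongr with i
          exact hM i A
      _ = _ := by simp
  calc _ = ∑ S : Finset ι, (-1 : ℝ) ^ S.card *
        Real.exp (-(u * ∑ T : Finset ι, if Disjoint T S then 0 else ν T)) := by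
        rw [real_forall_exists_false_eq]
        refine Finset.sum_congr rfl fun S _ => ?_
        rw [measureReal_def, hQ.2, ENNReal.toReal_ofReal (Real.exp_pos _).le,
          hP.capa_biUnion_eq_sum hd]
    _ ≤ _ := sum_neg_one_pow_mul_exp_le hν0 hu hl
    _ ≤ _ := by gcongr

/-- If finitely many well separated square rings are given, it is unlikely that all of them
contain a point of the interlacement set. -/
theorem real_forall_ring_le (hd : 3 ≤ d) (hP : IsSRW d P) {u : ℝ} (hu : 0 ≤ u)
    {Q : Measure (Zd d → Bool)} (hQ : IsVacantLaw P u Q) {l D c : ℝ} {R : ℕ} (hR : 1 ≤ R)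
    (hl : 1 ≤ l) (hc : 0 ≤ c) (C : Finset (ℤ × ℤ))
    (hone : ∀ w, ∀ x ∈ ring d R w, 1 ≤ c * ringGreen d R w x)
    (hfar : ∀ w w', 4 ≤ supDist w w' → ∀ x ∈ ring d R w,
      c * ringGreen d R w' x ≤ D * (1 / supDist w w'))
    (hsep : ∀ w ∈ C, ∀ w' ∈ C, w ≠ w' → 4 ≤ supDist w w')
    (hsmall : ∀ w ∈ C, 2 * l * (D * ∑ w' ∈ C.erase w, 1 / (supDist w w' : ℝ)) ≤ 1) :
    Q.real {Y | ∀ w ∈ C, ∃ x ∈ ring d R w, Y x = false} ≤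
      (l ^ C.card)⁻¹ * Real.exp (u * (2 * l * (C.card * (c * (squareBdry R).card)))) := by
  have h := hP.real_forall_exists_false_le hd hu hQ (ι := C) (K := fun w => ring d R w)
    (U := fun w x => c * ringGreen d R w x) (M := c * (squareBdry R).card) hl
    (fun w x => mul_nonneg hc (ringGreen_nonneg _ _)) ?_ (fun w x hx => hone w x hx) ?_ ?_ ?_
  · simpa using h
  · intro w x
    have := avg_ringGreen_le hd (R := R) (w : ℤ × ℤ) x
    have h2 : avg d (fun x => c * ringGreen d R w x) = c • avg d (ringGreen d R w) := by
      rw [← map_smul]; rfl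
    rw [h2]
    exact mul_le_mul_of_nonneg_left this hc
  · intro w x hx
    refine le_trans ?_ (hsmall w w.2)
    refine mul_le_mul_of_nonneg_left ?_ (by linarith)
    rw [Finset.mul_sum]
    calc _ ≤ ∑ j ∈ Finset.univ.erase w, D * (1 / (supDist w j : ℝ)) := by
          refine Finset.sum_le_sum fun j hj => hfar w j ?_ x hx
          exact hsep w w.2 j j.2 fun h => (Finset.mem_erase.mp hj).1 (Subtype.ext h.symm)
      _ = ∑ w' ∈ C.erase w, D * (1 / (supDist w w' : ℝ)) := by
          refine Finset.sum_bij (fun j _ => (j : ℤ × ℤ)) ?_ ?_ ?_ ?_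
          · intro j hj
            exact Finset.mem_erase.mpr ⟨fun h => (Finset.mem_erase.mp hj).1 (Subtype.ext h), j.2⟩
          · exact fun a _ b _ h => Subtype.ext h
          · intro b hb
            obtain ⟨h1, h2⟩ := Finset.mem_erase.mp hb
            exact ⟨⟨b, h2⟩, Finset.mem_erase.mpr ⟨fun h => h1 (congrArg Subtype.val h),
              Finset.mem_univ _⟩, rfl⟩
          · exact fun _ _ => rfl
  · intro w w' hww'
    exact disjoint_ring hd hR (hsep w w.2 w' w'.2 fun h => hww' (Subtype.ext h))
  · intro w A
    calc _ = c * ∑ s ∈ squareBdry R,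
          ∑ x ∈ A, eqm P A x * green (x - planePt d ((R : ℤ) • (w : ℤ × ℤ) + s)) := by
          rw [Finset.sum_comm, Finset.mul_sum]
          refine Finset.sum_congr rfl fun x _ => ?_
          rw [← Finset.mul_sum, ringGreen]
          ring
      _ ≤ c * ∑ _s ∈ squareBdry R, 1 := by
          gcongr with s
          exact hP.sum_green_mul_eqm_le hd _ A
      _ = _ := by simp

end IsSRW

/-- The families of `n + 1` points of `ℤ²` starting at `w`, each at distance at most `4` from the
previous one. -/
noncomputable def chains : ℕ → ℤ × ℤ → Finset (Finset (ℤ × ℤ))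
  | 0, w => {{w}}
  | n + 1, w => (Finset.Icc (-4) 4 ×ˢ Finset.Icc (-4) 4).biUnion fun v =>
      (chains n (w + v)).image (insert w)

theorem card_chains_le (n : ℕ) (w : ℤ × ℤ) : (chains n w).card ≤ 81 ^ n := by
  induction n generalizing w with
  | zero => simp [chains]
  | succ n ih =>
    rw [chains]
    refine (Finset.card_biUnion_le_card_mul _ _ (81 ^ n)
      fun v _ => Finset.card_image_le.trans (ih _)).trans ?_
    rw [Finset.card_product, pow_succ, mul_comm]
    simp

/-- The cell of side length `R` containing `z`. -/
def cell (R : ℕ) (z : ℤ × ℤ) : ℤ × ℤ := (z.1 / R, z.2 / R)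

theorem supDist_triangle (a b c : ℤ × ℤ) : supDist a c ≤ supDist a b + supDist b c := by
  simp only [supDist]
  have h1 := abs_sub_le a.1 b.1 c.1
  have h2 := abs_sub_le a.2 b.2 c.2
  have := le_max_left |a.1 - b.1| |a.2 - b.2|
  have := le_max_right |a.1 - b.1| |a.2 - b.2|
  have := le_max_left |b.1 - c.1| |b.2 - c.2|
  have := le_max_right |b.1 - c.1| |b.2 - c.2|
  exact max_le (by linarith) (by linarith)

theorem four_le_abs_ediv_sub {R : ℕ} (hR : 1 ≤ R) {a b : ℤ} (h : 4 * (R : ℤ) ≤ |a - b|) :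
    4 ≤ |a / R - b / R| := by
  have hR0 : (0 : ℤ) < R := by exact_mod_cast hR
  have h1 := Int.mul_ediv_add_emod a R
  have h2 := Int.mul_ediv_add_emod b R
  have h3 := Int.emod_nonneg a hR0.ne'
  have h4 := Int.emod_nonneg b hR0.ne'
  have h5 := Int.emod_lt_of_pos a hR0
  have h6 := Int.emod_lt_of_pos b hR0
  by_contra! hlt
  obtain ⟨h7, h8⟩ := abs_lt.mp hlt
  rcases le_abs'.mp h with h | h
  · nlinarith
  · nlinarith

theorem abs_ediv_sub_le_four {R : ℕ} (hR : 1 ≤ R) {a b : ℤ} (h : |a - b| ≤ 4 * (R : ℤ)) :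
    |a / R - b / R| ≤ 4 := by
  have hR0 : (0 : ℤ) < R := by exact_mod_cast hR
  have h1 := Int.mul_ediv_add_emod a R
  have h2 := Int.mul_ediv_add_emod b R
  have h3 := Int.emod_nonneg a hR0.ne'
  have h4 := Int.emod_nonneg b hR0.ne'
  have h5 := Int.emod_lt_of_pos a hR0
  have h6 := Int.emod_lt_of_pos b hR0
  obtain ⟨h7, h8⟩ := abs_le.mp h
  by_contra! hlt
  rcases lt_abs.mp hlt with h | h
  · nlinarith
  · nlinarith

theorem four_le_supDist_cell {R : ℕ} (hR : 1 ≤ R) {a b : ℤ × ℤ} (h : 4 * (R : ℤ) ≤ supDist a b) :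
    4 ≤ supDist (cell R a) (cell R b) := by
  rcases le_max_iff.mp h with h | h
  · exact le_max_of_le_left (four_le_abs_ediv_sub hR h)
  · exact le_max_of_le_right (four_le_abs_ediv_sub hR h)

theorem exists_chain {R N : ℕ} (hR : 1 ≤ R) {z : ℕ → ℤ × ℤ}
    (hz : ∀ k < N, supDist (z k) (z (k + 1)) ≤ 1) (n s : ℕ) (hs : s ≤ N)
    (hfar : 4 * (R : ℤ) * (n + 1) ≤ supDist (z s) (z N)) :
    ∃ C ∈ chains n (cell R (z s)), C.card = n + 1 ∧
      (∀ w ∈ C, ∀ w' ∈ C, w ≠ w' → 4 ≤ supDist w w') ∧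
      ∀ w ∈ C, ∃ i, s ≤ i ∧ i ≤ N ∧ w = cell R (z i) ∧ 4 * (R : ℤ) ≤ supDist (z i) (z N) := by
  have hR0 : (0 : ℤ) < R := by exact_mod_cast hR
  induction n generalizing s with
  | zero =>
    refine ⟨{cell R (z s)}, by simp [chains], by simp, by simp, fun w hw => ⟨s, le_rfl, hs, ?_, ?_⟩⟩
    · simpa using hw
    · simpa using hfar
  | succ n ih =>
    have hself : supDist (z s) (z s) = 0 := by simp [supDist]
    push_cast at hfar
    have hN : 4 * (R : ℤ) ≤ supDist (z s) (z N) := by nlinarith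
    obtain ⟨t, ht, htR, hafter⟩ : ∃ t, (s ≤ t ∧ t < N) ∧ supDist (z s) (z t) < 4 * R ∧
        ∀ i, t < i → i ≤ N → 4 * (R : ℤ) ≤ supDist (z s) (z i) := by
      let p : ℕ → Prop := fun i => supDist (z s) (z i) < 4 * R
      classical
      have hps : p s := by simp only [p, hself]; linarith
      refine ⟨Nat.findGreatest p N, ⟨Nat.le_findGreatest hs hps, ?_⟩,
        Nat.findGreatest_spec (P := p) hs hps, fun i hi hiN => ?_⟩
      · refine lt_of_le_of_ne (Nat.findGreatest_le N) fun h => ?_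
        have := Nat.findGreatest_spec (P := p) hs hps
        rw [h] at this
        simp only [p] at this
        linarith
      · exact not_lt.mp (Nat.findGreatest_is_greatest (P := p) hi hiN)
    have hstep := hz t ht.2
    have hle : supDist (z s) (z (t + 1)) ≤ 4 * R := by
      have := supDist_triangle (z s) (z t) (z (t + 1))
      omega
    obtain ⟨C, hC, hcard, hsep, hidx⟩ := ih (t + 1) (by omega) (by
      have := supDist_triangle (z s) (z (t + 1)) (z N)
      nlinarith)
    have hnew : ∀ w ∈ C, 4 ≤ supDist (cell R (z s)) w := by
      intro w hw
      obtain ⟨i, hi, hiN, rfl, -⟩ := hidx w hw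
      exact four_le_supDist_cell hR (hafter i (by omega) hiN)
    have hnot : cell R (z s) ∉ C := fun h => by
      have := hnew _ h
      simp [supDist] at this
    refine ⟨insert (cell R (z s)) C, ?_, by rw [Finset.card_insert_of_notMem hnot, hcard], ?_, ?_⟩
    · rw [chains, Finset.mem_biUnion]
      refine ⟨cell R (z (t + 1)) - cell R (z s), ?_, ?_⟩
      · have h1 := abs_ediv_sub_le_four hR ((le_max_left _ _).trans hle)
        have h2 := abs_ediv_sub_le_four hR ((le_max_right _ _).trans hle)
        rw [abs_sub_comm] at h1 h2
        rw [abs_le] at h1 h2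
        simp only [Finset.mem_product, Finset.mem_Icc]
        exact ⟨h1, h2⟩
      · rw [add_sub_cancel]
        exact Finset.mem_image_of_mem _ hC
    · intro w hw w' hw' hne
      rcases Finset.mem_insert.mp hw with rfl | hw <;> rcases Finset.mem_insert.mp hw' with rfl | hw'
      · exact absurd rfl hne
      · exact hnew w' hw'
      · rw [supDist_comm]; exact hnew w hw
      · exact hsep w hw w' hw' hne
    · intro w hw
      rcases Finset.mem_insert.mp hw with rfl | hw
      · exact ⟨s, le_rfl, hs, rfl, hN⟩
      · obtain ⟨i, hi, h⟩ := hidx w hw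
        exact ⟨i, by omega, h⟩

theorem exists_crossing {R N i : ℕ} (hR : 1 ≤ R) {z : ℕ → ℤ × ℤ}
    (hz : ∀ k < N, supDist (z k) (z (k + 1)) ≤ 1) (hi : i ≤ N)
    (hfar : 4 * (R : ℤ) ≤ supDist (z i) (z N)) :
    ∃ j ≤ N, z j - (R : ℤ) • cell R (z i) ∈ squareBdry R := by
  have hR0 : (0 : ℤ) < R := by exact_mod_cast hR
  set c := (R : ℤ) • cell R (z i) with hc
  have h0 : supDist (z i) c < R := by
    have h1 := Int.mul_ediv_add_emod (z i).1 R
    have h2 := Int.mul_ediv_add_emod (z i).2 R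
    have h3 := Int.emod_nonneg (z i).1 hR0.ne'
    have h4 := Int.emod_nonneg (z i).2 hR0.ne'
    have h5 := Int.emod_lt_of_pos (z i).1 hR0
    have h6 := Int.emod_lt_of_pos (z i).2 hR0
    simp only [supDist, hc, cell, Prod.smul_fst, Prod.smul_snd, smul_eq_mul, max_lt_iff, abs_lt]
    refine ⟨⟨?_, ?_⟩, ?_, ?_⟩ <;> linarith
  have hN : (R : ℤ) ≤ supDist (z N) c := by
    have := supDist_triangle (z i) c (z N)
    rw [supDist_comm c] at this
    linarith
  obtain ⟨j, hjN, hjR⟩ : ∃ j ≤ N, supDist (z j) c = R := by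
    let p : ℕ → Prop := fun j => supDist (z j) c < R
    classical
    have hlt : Nat.findGreatest p N < N := by
      refine lt_of_le_of_ne (Nat.findGreatest_le N) fun h => ?_
      have := Nat.findGreatest_spec (P := p) hi h0
      rw [h] at this
      simp only [p] at this
      linarith
    have h1 : supDist (z (Nat.findGreatest p N)) c < R := Nat.findGreatest_spec (P := p) hi h0
    have h2 := not_lt.mp (Nat.findGreatest_is_greatest (P := p) (Nat.lt_succ_self _) hlt)
    refine ⟨Nat.findGreatest p N + 1, hlt, le_antisymm ?_ h2⟩
    have h3 := supDist_triangle (z (Nat.findGreatest p N + 1)) (z (Nat.findGreatest p N)) c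
    have h4 := hz _ hlt
    rw [supDist_comm] at h4
    linarith
  refine ⟨j, hjN, ?_⟩
  simp only [supDist] at hjR
  have h1 : |(z j - c).1| ≤ R := (le_max_left _ _).trans hjR.le
  have h2 : |(z j - c).2| ≤ R := (le_max_right _ _).trans hjR.le
  rw [mem_squareBdry]
  rcases max_choice |(z j).1 - c.1| |(z j).2 - c.2| with h | h <;> rw [hjR] at h
  · refine Or.inl ⟨?_, abs_le.mp h2⟩
    rcases (abs_eq hR0.le).mp h.symm with h | h
    · exact Or.inr h
    · exact Or.inl h
  · refine Or.inr ⟨abs_le.mp h1, ?_⟩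
    rcases (abs_eq hR0.le).mp h.symm with h | h
    · exact Or.inr h
    · exact Or.inl h

theorem inPlane.eq_planePt {d : ℕ} {x : Zd d} (hx : inPlane x) :
    x = planePt d (coord x 0, coord x 1) := by
  funext i
  simp only [planePt, coord]
  by_cases h0 : (i : ℕ) = 0
  · have : 0 < d := by omega
    simp only [h0, this, if_true, dif_pos]
    congr 1; exact Fin.ext h0
  · by_cases h1 : (i : ℕ) = 1
    · have : 1 < d := by omega
      simp only [h1, this, dif_pos]
      simp only [one_ne_zero, if_false, if_true]
      congr 1; exact Fin.ext h1
    · simp only [h0, h1, if_false]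
      exact hx i (by omega)

theorem exists_chain_of_mem_qEvent {d : ℕ} (hd : 3 ≤ d) {L R n : ℕ} (hR : 1 ≤ R)
    (hL : 4 * R * (n + 1) ≤ 2 * L) {Y : Zd d → Bool} (hY : Y ∈ qEvent d L) :
    ∃ a ∈ Finset.Icc (-(L : ℤ)) L ×ˢ Finset.Icc (-(L : ℤ)) L, ∃ C ∈ chains n a, C.card = n + 1 ∧
      (∀ w ∈ C, ∀ w' ∈ C, w ≠ w' → 4 ≤ supDist w w') ∧
      ∀ w ∈ C, ∃ x ∈ ring d R w, Y x = false := by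
  have hR0 : (0 : ℤ) < R := by exact_mod_cast hR
  have hL0 : 1 ≤ L := by
    rcases Nat.eq_zero_or_pos L with rfl | h
    · have : 0 < 4 * R * (n + 1) := by positivity
      omega
    · exact h
  obtain ⟨N, w, ⟨-, hstart⟩, ⟨-, y, hy, hadj⟩, hocc, hpath⟩ := hY
  set z : ℕ → ℤ × ℤ := fun k => (coord (w k) 0, coord (w k) 1) with hzdef
  have hc0 : ∀ x : Zd d, coord x 0 = x ⟨0, by omega⟩ := fun x => by simp [coord, show 0 < d by omega]
  have hc1 : ∀ x : Zd d, coord x 1 = x ⟨1, by omega⟩ := fun x => by simp [coord, show 1 < d by omega]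
  have hz : ∀ k < N, supDist (z k) (z (k + 1)) ≤ 1 := by
    intro k hk
    have := (hpath k hk).2
    simp only [supDist, hzdef, hc0, hc1]
    exact max_le (this _) (this _)
  have h0 := hstart ⟨0, by omega⟩
  have h1 := hstart ⟨1, by omega⟩
  rw [← hc0 (w 0)] at h0
  rw [← hc1 (w 0)] at h1
  have hfar : 2 * (L : ℤ) ≤ supDist (z 0) (z N) := by
    simp only [Set.mem_ofPred_eq, not_forall, not_le] at hy
    obtain ⟨i, hi⟩ := hy
    have hle : |w N i - y i| ≤ 1 := by
      rw [← hadj]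
      exact Finset.single_le_sum (f := fun i => |w N i - y i|) (fun j _ => abs_nonneg _)
        (Finset.mem_univ i)
    have hbig : 3 * (L : ℤ) ≤ |w N i| := by
      have := abs_sub_abs_le_abs_sub (y i) (w N i)
      rw [abs_sub_comm] at this
      linarith
    have hi2 : (i : ℕ) < 2 := by
      by_contra! h
      rw [(hocc N le_rfl).1 i h, abs_zero] at hbig
      omega
    have hcases : (i : ℕ) = 0 ∨ (i : ℕ) = 1 := by omega
    rcases hcases with h | h
    · refine le_max_of_le_left ?_
      have e : w N i = coord (w N) 0 := by rw [hc0]; congr 1; exact Fin.ext h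
      rw [e] at hbig
      have := abs_sub_abs_le_abs_sub (coord (w N) 0) (coord (w 0) 0)
      rw [abs_sub_comm] at this
      simp only [hzdef]
      linarith
    · refine le_max_of_le_right ?_
      have e : w N i = coord (w N) 1 := by rw [hc1]; congr 1; exact Fin.ext h
      rw [e] at hbig
      have := abs_sub_abs_le_abs_sub (coord (w N) 1) (coord (w 0) 1)
      rw [abs_sub_comm] at this
      simp only [hzdef]
      linarith
  have hLz : 4 * (R : ℤ) * (n + 1) ≤ 2 * L := by exact_mod_cast hL
  obtain ⟨C, hC, hcard, hsep, hidx⟩ := exists_chain hR hz n 0 (Nat.zero_le N) (hLz.trans hfar)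
  refine ⟨cell R (z 0), ?_, C, hC, hcard, hsep, fun v hv => ?_⟩
  · have hb : ∀ a : ℤ, |a| ≤ L → a / R ∈ Finset.Icc (-(L : ℤ)) L := by
      intro a ha
      obtain ⟨h2, h3⟩ := abs_le.mp ha
      rw [Finset.mem_Icc]
      refine ⟨Int.le_ediv_of_mul_le hR0 (by nlinarith), ?_⟩
      exact Int.ediv_le_of_le_mul hR0 (by nlinarith)
    exact Finset.mem_product.mpr ⟨hb _ h0, hb _ h1⟩
  · obtain ⟨i, -, hiN, rfl, hfar'⟩ := hidx v hv
    obtain ⟨j, hjN, hj⟩ := exists_crossing hR hz hiN hfar'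
    refine ⟨w j, ?_, (hocc j hjN).2⟩
    refine Finset.mem_image.mpr ⟨_, hj, ?_⟩
    rw [add_sub_cancel]
    exact ((hocc j hjN).1.eq_planePt).symm

theorem sum_inv_sqrt_abs_le (m : ℕ) :
    ∑ a ∈ Finset.Icc (-(m : ℤ)) m, 1 / Real.sqrt (|(a : ℝ)| + 1) ≤ 4 * Real.sqrt (m + 1) := by
  have hmaps : ∀ a ∈ Finset.Icc (-(m : ℤ)) m, a.natAbs ∈ Finset.range (m + 1) := by
    intro a ha
    rw [Finset.mem_Icc] at ha
    rw [Finset.mem_range]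
    omega
  rw [← Finset.sum_fiberwise_of_maps_to hmaps]
  calc _ ≤ ∑ k ∈ Finset.range (m + 1), 2 * (1 / Real.sqrt ((k : ℝ) + 1)) := by
        refine Finset.sum_le_sum fun k _ => ?_
        calc _ = ∑ a ∈ (Finset.Icc (-(m : ℤ)) m).filter fun a => a.natAbs = k,
              1 / Real.sqrt ((k : ℝ) + 1) := by
              refine Finset.sum_congr rfl fun a ha => ?_
              rw [← (Finset.mem_filter.mp ha).2, Nat.cast_natAbs, Int.cast_abs]
          _ ≤ 2 * (1 / Real.sqrt ((k : ℝ) + 1)) := by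
              rw [Finset.sum_const, nsmul_eq_mul]
              refine mul_le_mul_of_nonneg_right ?_ (by positivity)
              have : (Finset.Icc (-(m : ℤ)) m).filter (fun a => a.natAbs = k) ⊆ {(k : ℤ), -(k : ℤ)} := by
                intro a ha
                have := (Finset.mem_filter.mp ha).2
                simp only [Finset.mem_insert, Finset.mem_singleton]
                omega
              exact_mod_cast (Finset.card_le_card this).trans Finset.card_le_two
    _ ≤ _ := by
        rw [← Finset.mul_sum]
        have := sum_range_inv_sqrt_le (m + 1)
        push_cast at this
        linarith

theorem inv_max_abs_le {a b : ℤ} (h : a ≠ 0 ∨ b ≠ 0) :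
    1 / ((max |a| |b| : ℤ) : ℝ) ≤
      2 * (1 / Real.sqrt (|(a : ℝ)| + 1) * (1 / Real.sqrt (|(b : ℝ)| + 1))) := by
  have h1 : 1 ≤ max |a| |b| := by
    rcases h with h | h
    · exact le_max_of_le_left (Int.one_le_abs h)
    · exact le_max_of_le_right (Int.one_le_abs h)
  have ha := le_max_left |a| |b|
  have hb := le_max_right |a| |b|
  generalize max |a| |b| = m at h1 ha hb
  rify at h1 ha hb
  set M : ℝ := (m : ℝ)
  have hs : Real.sqrt (|(a : ℝ)| + 1) * Real.sqrt (|(b : ℝ)| + 1) ≤ 2 * M := by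
    calc _ ≤ Real.sqrt (2 * M) * Real.sqrt (2 * M) := by gcongr <;> linarith
      _ = 2 * M := Real.mul_self_sqrt (by linarith)
  have hpos : 0 < Real.sqrt (|(a : ℝ)| + 1) * Real.sqrt (|(b : ℝ)| + 1) := by positivity
  rw [one_div_mul_one_div, ← mul_one_div, mul_comm, ← sub_nonneg]
  have : 2 * M * (1 / (2 * M)) = 1 := by field_simp
  have h3 := one_div_le_one_div_of_le hpos hs
  have h4 : 1 / (2 * M) = 1 / 2 * (1 / M) := by field_simp
  linarith

theorem sum_one_div_supDist_le (C : Finset (ℤ × ℤ)) (w : ℤ × ℤ) {k : ℕ} (hk : C.card ≤ k)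
    (hk1 : 1 ≤ k) :
    ∑ w' ∈ C.erase w, 1 / (supDist w w' : ℝ) ≤ 100 * Real.sqrt k := by
  set m := ⌈Real.sqrt k⌉₊ with hm
  have hk1' : (1 : ℝ) ≤ k := by exact_mod_cast hk1
  have hs1 : 1 ≤ Real.sqrt k := Real.one_le_sqrt.mpr hk1'
  have hm1 : Real.sqrt k ≤ m := Nat.le_ceil _
  have hm2 : (m : ℝ) < Real.sqrt k + 1 := Nat.ceil_lt_add_one (by positivity)
  rw [← Finset.sum_filter_add_sum_filter_not (C.erase w) fun w' => supDist w w' ≤ m]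
  have hnear : ∑ w' ∈ (C.erase w).filter (fun w' => supDist w w' ≤ m), 1 / (supDist w w' : ℝ)
      ≤ 32 * (m + 1) := by
    calc _ ≤ ∑ w' ∈ (C.erase w).filter (fun w' => supDist w w' ≤ m),
          2 * (1 / Real.sqrt (|((w.1 - w'.1 : ℤ) : ℝ)| + 1) *
            (1 / Real.sqrt (|((w.2 - w'.2 : ℤ) : ℝ)| + 1))) := by
          refine Finset.sum_le_sum fun w' hw' => inv_max_abs_le ?_
          have hne := (Finset.mem_erase.mp (Finset.mem_filter.mp hw').1).1
          by_contra! h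
          exact hne (Prod.ext (by omega) (by omega))
      _ = ∑ v ∈ ((C.erase w).filter (fun w' => supDist w w' ≤ m)).image (fun w' => w - w'),
          2 * (1 / Real.sqrt (|((v.1 : ℤ) : ℝ)| + 1) *
            (1 / Real.sqrt (|((v.2 : ℤ) : ℝ)| + 1))) := by
          rw [Finset.sum_image fun a _ b _ h => sub_right_injective h]
          rfl
      _ ≤ ∑ v ∈ Finset.Icc (-(m : ℤ)) m ×ˢ Finset.Icc (-(m : ℤ)) m,
          2 * (1 / Real.sqrt (|((v.1 : ℤ) : ℝ)| + 1) *
            (1 / Real.sqrt (|((v.2 : ℤ) : ℝ)| + 1))) := by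
          refine Finset.sum_le_sum_of_subset_of_nonneg ?_ fun v _ _ => by positivity
          intro v hv
          obtain ⟨w', hw', rfl⟩ := Finset.mem_image.mp hv
          have h := (Finset.mem_filter.mp hw').2
          simp only [Finset.mem_product, Finset.mem_Icc]
          exact ⟨abs_le.mp ((le_max_left _ _).trans h), abs_le.mp ((le_max_right _ _).trans h)⟩
      _ = 2 * ((∑ a ∈ Finset.Icc (-(m : ℤ)) m, 1 / Real.sqrt (|(a : ℝ)| + 1)) *
          ∑ a ∈ Finset.Icc (-(m : ℤ)) m, 1 / Real.sqrt (|(a : ℝ)| + 1)) := by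
          rw [Finset.sum_mul_sum, Finset.sum_product, Finset.mul_sum]
          exact Finset.sum_congr rfl fun a _ => (Finset.mul_sum _ _ _).symm
      _ ≤ 2 * ((4 * Real.sqrt (m + 1)) * (4 * Real.sqrt (m + 1))) := by
          have := sum_inv_sqrt_abs_le m
          gcongr
      _ = 32 * (m + 1) := by
          have := Real.mul_self_sqrt (show (0 : ℝ) ≤ m + 1 by positivity)
          linear_combination 32 * this
  have hfar : ∑ w' ∈ (C.erase w).filter (fun w' => ¬ supDist w w' ≤ m), 1 / (supDist w w' : ℝ)
      ≤ Real.sqrt k := by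
    calc _ ≤ ∑ w' ∈ (C.erase w).filter (fun w' => ¬ supDist w w' ≤ m), 1 / Real.sqrt k := by
          refine Finset.sum_le_sum fun w' hw' => ?_
          have h := not_le.mp (Finset.mem_filter.mp hw').2
          have h' : (m : ℝ) < supDist w w' := by exact_mod_cast h
          exact one_div_le_one_div_of_le (by linarith) (by linarith)
      _ ≤ k * (1 / Real.sqrt k) := by
          rw [Finset.sum_const, nsmul_eq_mul]
          refine mul_le_mul_of_nonneg_right ?_ (by positivity)
          have h1 := Finset.card_filter_le (C.erase w) fun w' => ¬ supDist w w' ≤ m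
          have h2 := Finset.card_le_card (Finset.erase_subset w C)
          exact_mod_cast h1.trans (h2.trans hk)
      _ = Real.sqrt k := by rw [mul_one_div, Real.div_sqrt]
  linarith

theorem IsSRW.exists_real_qEvent_le {d : ℕ} (hd : 3 ≤ d) {P : Zd d → Measure (ℕ → Zd d)}
    (hP : IsSRW d P) : ∃ D : ℝ, 0 < D ∧ ∀ (R n L : ℕ) (u l : ℝ) (Q : Measure (Zd d → Bool)),
      2 ≤ R → 4 * R * (n + 1) ≤ 2 * L → 1 ≤ l → 0 ≤ u → IsVacantLaw P u Q →
      2 * l * (D / Real.log R * (100 * Real.sqrt (n + 1))) ≤ 1 →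
      Q.real (qEvent d L) ≤ (2 * L + 1) ^ 2 * 81 ^ n * ((l ^ (n + 1))⁻¹ *
        Real.exp (u * (2 * l * ((n + 1) * (D * (R : ℝ) ^ (d - 2) / Real.log R))))) := by
  classical
  obtain ⟨D, hD, hpot⟩ := exists_ring_potential hd
  refine ⟨D, hD, fun R n L u l Q hR hL hl hu hQ hsmall => ?_⟩
  obtain ⟨c, hc, hone, hfar, hcard⟩ := hpot R hR
  have hQp := hQ.1
  have hlog : 0 < Real.log R := Real.log_pos (by exact_mod_cast (by omega : 1 < R))
  set β := (l ^ (n + 1))⁻¹ *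
    Real.exp (u * (2 * l * ((n + 1) * (D * (R : ℝ) ^ (d - 2) / Real.log R)))) with hβ
  set box := Finset.Icc (-(L : ℤ)) L ×ˢ Finset.Icc (-(L : ℤ)) L with hbox
  set good : ℤ × ℤ → Finset (Finset (ℤ × ℤ)) := fun a => (chains n a).filter fun C =>
    C.card = n + 1 ∧ ∀ w ∈ C, ∀ w' ∈ C, w ≠ w' → 4 ≤ supDist w w' with hgood
  have hβ0 : 0 ≤ β := by positivity
  have hC : ∀ a, ∀ C ∈ good a, Q.real {Y | ∀ w ∈ C, ∃ x ∈ ring d R w, Y x = false} ≤ β := by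
    intro a C hCa
    obtain ⟨-, hk, hsep⟩ := Finset.mem_filter.mp hCa
    refine (hP.real_forall_ring_le hd hu hQ (by omega) hl hc.le C hone hfar hsep ?_).trans ?_
    · intro w _
      refine le_trans ?_ hsmall
      have := sum_one_div_supDist_le C w hk.le (by omega)
      push_cast at this
      gcongr
    · rw [hk, hβ]
      push_cast
      gcongr
  have hsub : qEvent d L ⊆ ⋃ a ∈ box, ⋃ C ∈ good a,
      {Y | ∀ w ∈ C, ∃ x ∈ ring d R w, Y x = false} := by
    intro Y hY
    obtain ⟨a, ha, C, hCa, hk, hsep, hYC⟩ := exists_chain_of_mem_qEvent hd (by omega) hL hY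
    simp only [Set.mem_iUnion]
    exact ⟨a, ha, C, Finset.mem_filter.mpr ⟨hCa, hk, hsep⟩, hYC⟩
  calc Q.real (qEvent d L)
      ≤ Q.real (⋃ a ∈ box, ⋃ C ∈ good a, {Y | ∀ w ∈ C, ∃ x ∈ ring d R w, Y x = false}) :=
        measureReal_mono hsub (measure_ne_top _ _)
    _ ≤ ∑ a ∈ box, Q.real (⋃ C ∈ good a, {Y | ∀ w ∈ C, ∃ x ∈ ring d R w, Y x = false}) :=
        measureReal_biUnion_finset_le _ _
    _ ≤ ∑ _a ∈ box, (81 : ℝ) ^ n * β := by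
        refine Finset.sum_le_sum fun a _ => (measureReal_biUnion_finset_le _ _).trans ?_
        refine (Finset.sum_le_card_nsmul _ _ β (hC a)).trans ?_
        rw [nsmul_eq_mul]
        refine mul_le_mul_of_nonneg_right ?_ hβ0
        exact_mod_cast (Finset.card_filter_le _ _).trans (card_chains_le n a)
    _ = _ := by
        rw [Finset.sum_const, nsmul_eq_mul, hbox, Finset.card_product, Int.card_Icc,
          show (L : ℤ) + 1 - -(L : ℤ) = ((2 * L + 1 : ℕ) : ℤ) by push_cast; ring, Int.toNat_natCast]
        push_cast
        ring

theorem tendsto_log_natCast_atTop : Tendsto (fun L : ℕ => Real.log L) atTop atTop :=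
  Real.tendsto_log_atTop.comp tendsto_natCast_atTop_atTop

theorem eventually_mul_sqrt_add_one_le :
    ∀ᶠ L : ℕ in atTop, 2 * (Real.log L ^ 2 + 1) * (Real.sqrt L + 1) ≤ (L : ℝ) := by
  have h1 : ∀ᶠ x : ℝ in atTop, Real.log x ≤ x ^ (1 / 8 : ℝ) := by
    filter_upwards [(isLittleO_log_rpow_atTop (show (0 : ℝ) < 1 / 8 by norm_num)).bound one_pos,
      eventually_ge_atTop 1] with x hx hx1
    rw [Real.norm_of_nonneg (Real.log_nonneg hx1), Real.norm_of_nonneg (by positivity)] at hx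
    linarith
  have h2 := tendsto_rpow_atTop (show (0 : ℝ) < 1 / 8 by norm_num)
  have h3 : ∀ᶠ x : ℝ in atTop, 2 * (Real.log x ^ 2 + 1) * (Real.sqrt x + 1) ≤ x := by
    filter_upwards [h1, h2.eventually_ge_atTop 3, eventually_ge_atTop 1] with x hx ht hx1
    set t := x ^ (1 / 8 : ℝ) with htdef
    have ht0 : 0 ≤ t := by linarith
    have hx8 : x = t ^ 8 := by
      rw [htdef, ← Real.rpow_natCast, ← Real.rpow_mul (by linarith)]; norm_num
    have hsq : Real.sqrt x = t ^ 4 := by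
      rw [hx8, show t ^ 8 = (t ^ 4) ^ 2 by ring, Real.sqrt_sq (by positivity)]
    have hl2 : Real.log x ^ 2 ≤ t ^ 2 := pow_le_pow_left₀ (Real.log_nonneg hx1) hx 2
    have h9 : 9 ≤ t ^ 2 := by nlinarith
    have h4 : 1 ≤ t ^ 4 := one_le_pow₀ (by linarith)
    rw [hsq]
    calc 2 * (Real.log x ^ 2 + 1) * (t ^ 4 + 1) ≤ 2 * (t ^ 2 + t ^ 2) * (t ^ 4 + t ^ 4) := by
          gcongr
          linarith
      _ = 8 * t ^ 6 := by ring
      _ ≤ t ^ 2 * t ^ 6 := by gcongr; linarith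
      _ = x := by rw [hx8]; ring
  exact tendsto_natCast_atTop_atTop.eventually h3

theorem tendsto_exp_log_sub_atTop (B : ℝ) :
    Tendsto (fun L : ℕ => 9 * Real.exp (B * Real.log L - Real.log L * Real.sqrt (Real.log L)))
      atTop (nhds 0) := by
  have h1 : Tendsto (fun y : ℝ => y * (Real.sqrt y - B)) atTop atTop :=
    tendsto_id.atTop_mul_atTop₀ (tendsto_atTop_add_const_right _ (-B) Real.tendsto_sqrt_atTop)
  have h2 := Real.tendsto_exp_neg_atTop_nhds_zero.comp (h1.comp tendsto_log_natCast_atTop)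
  have h3 := h2.const_mul 9
  rw [mul_zero] at h3
  refine h3.congr fun L => ?_
  simp only [Function.comp]
  congr 2
  ring

theorem IsSRW.eventually_real_qEvent_le {d : ℕ} (hd : 3 ≤ d) {κ : ℝ} (hκ : 0 < κ)
    {P : Zd d → Measure (ℕ → Zd d)} (hP : IsSRW d P) :
    ∃ B : ℝ, ∀ᶠ L : ℕ in atTop, ∀ Q : Measure (Zd d → Bool),
      IsVacantLaw P (κ * (Real.log L) ^ 2 * (L : ℝ) ^ (-((d : ℝ) - 2))) Q →
      Q.real (qEvent d L) ≤
        9 * Real.exp (B * Real.log L - Real.log L * Real.sqrt (Real.log L)) := by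
  obtain ⟨D, hD, hbound⟩ := hP.exists_real_qEvent_le hd
  set l : ℝ := 81 * Real.exp 1 with hldef
  have hl : 1 ≤ l := by linarith [Real.add_one_le_exp 1]
  have hl0 : 0 < l := by linarith
  refine ⟨2 + 2 * κ * l * D, ?_⟩
  filter_upwards [eventually_mul_sqrt_add_one_le, eventually_ge_atTop 4,
    tendsto_log_natCast_atTop.eventually_ge_atTop 1,
    (Real.tendsto_sqrt_atTop.comp tendsto_log_natCast_atTop).eventually_ge_atTop
      (2 * (400 * l * D) ^ 2)] with L hLbig hL4 hlog1 hsqrt Q hQ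
  simp only [Function.comp] at hsqrt
  set y := Real.log L with hy
  have hL4' : (4 : ℝ) ≤ L := by exact_mod_cast hL4
  have hL0 : (0 : ℝ) < L := by linarith
  have hs1 : 1 ≤ Real.sqrt y := Real.one_le_sqrt.mpr hlog1
  have hss : Real.sqrt y * Real.sqrt y = y := Real.mul_self_sqrt (by linarith)
  set n := ⌊y * Real.sqrt y⌋₊ with hn
  have hn1 : (n : ℝ) ≤ y * Real.sqrt y := Nat.floor_le (by positivity)
  have hn2 : y * Real.sqrt y < n + 1 := Nat.lt_floor_add_one _
  have hny : (n : ℝ) ≤ y ^ 2 := by nlinarith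
  set R := L / (2 * (n + 1)) with hR
  have hRL : R * (2 * (n + 1)) ≤ L := Nat.div_mul_le_self L _
  have hRL' : (R : ℝ) * (2 * (n + 1)) ≤ L := by exact_mod_cast hRL
  have hRsqrt : Real.sqrt L ≤ R := by
    have h1 : L < (R + 1) * (2 * (n + 1)) := by
      have := Nat.lt_div_mul_add (a := L) (b := 2 * (n + 1)) (by omega)
      rw [← hR] at this
      linarith
    have h1' : (L : ℝ) < (R + 1) * (2 * (n + 1)) := by exact_mod_cast h1
    by_contra! hlt
    have h2 : ((R : ℝ) + 1) * (2 * (n + 1)) ≤ (Real.sqrt L + 1) * (2 * (y ^ 2 + 1)) := by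
      gcongr
    linarith
  have hR2' : (2 : ℝ) ≤ R := by
    refine le_trans ?_ hRsqrt
    exact Real.le_sqrt_of_sq_le (by linarith)
  have hR2 : 2 ≤ R := by exact_mod_cast hR2'
  have hlogR : y / 2 ≤ Real.log R := by
    rw [hy, ← Real.log_sqrt hL0.le]
    exact Real.log_le_log (Real.sqrt_pos.mpr hL0) hRsqrt
  have hsmall : 2 * l * (D / Real.log R * (100 * Real.sqrt (n + 1))) ≤ 1 := by
    have h1 : Real.sqrt (n + 1) ≤ y / (400 * l * D) := by
      rw [Real.sqrt_le_left (by positivity)]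
      rw [div_pow, le_div_iff₀ (by positivity)]
      have h2 : (n : ℝ) + 1 ≤ 2 * (y * Real.sqrt y) := by nlinarith
      calc ((n : ℝ) + 1) * (400 * l * D) ^ 2 ≤ 2 * (y * Real.sqrt y) * (400 * l * D) ^ 2 := by
            gcongr
        _ = y * Real.sqrt y * (2 * (400 * l * D) ^ 2) := by ring
        _ ≤ y * Real.sqrt y * Real.sqrt y := by gcongr
        _ = y ^ 2 := by rw [mul_assoc, hss, sq]
    calc _ ≤ 2 * l * (D / (y / 2) * (100 * (y / (400 * l * D)))) := by gcongr
      _ = 1 := by field_simp; norm_num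
  have hu : (κ * y ^ 2 * (L : ℝ) ^ (-((d : ℝ) - 2))) = κ * y ^ 2 * ((L : ℝ) ^ (d - 2))⁻¹ := by
    rw [Real.rpow_neg hL0.le, ← Real.rpow_natCast (L : ℝ) (d - 2), Nat.cast_sub (by omega),
      Nat.cast_two]
  rw [hu] at hQ
  have hmain := hbound R n L _ l Q hR2 (by nlinarith) hl (by positivity) hQ hsmall
  have hexp : κ * y ^ 2 * ((L : ℝ) ^ (d - 2))⁻¹ *
      (2 * l * ((n + 1) * (D * (R : ℝ) ^ (d - 2) / Real.log R))) ≤ 2 * κ * l * D * y := by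
    have hRleL : (R : ℝ) / L ≤ 1 := by
      rw [div_le_one hL0]
      have : (0 : ℝ) ≤ R * n := by positivity
      linarith
    have hpow : ((R : ℝ) / L) ^ (d - 2) ≤ R / L :=
      pow_le_of_le_one (by positivity) hRleL (by omega)
    have hk : ((n : ℝ) + 1) * (R / L) ≤ 1 / 2 := by
      rw [mul_div_assoc', div_le_iff₀ hL0]
      linarith
    calc _ = 2 * κ * l * D * y ^ 2 * ((n + 1) * ((R : ℝ) / L) ^ (d - 2)) / Real.log R := by
          rw [div_pow]; ring
      _ ≤ 2 * κ * l * D * y ^ 2 * (1 / 2) / (y / 2) := by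
          gcongr
          exact (mul_le_mul_of_nonneg_left hpow (by positivity)).trans hk
      _ = _ := by field_simp
  calc Q.real (qEvent d L) ≤ _ := hmain
    _ ≤ (3 * L) ^ 2 * 81 ^ n * ((l ^ (n + 1))⁻¹ * Real.exp (2 * κ * l * D * y)) := by
        gcongr
        linarith
    _ ≤ (3 * L) ^ 2 * (Real.exp (-(n + 1)) * Real.exp (2 * κ * l * D * y)) := by
        rw [mul_assoc ((3 * (L : ℝ)) ^ 2), ← mul_assoc ((81 : ℝ) ^ n)]
        gcongr
        rw [hldef, mul_pow, ← Real.exp_nat_mul, mul_inv, ← Real.exp_neg, ← mul_assoc]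
        push_cast
        rw [mul_one]
        refine mul_le_of_le_one_left (Real.exp_pos _).le ?_
        rw [← div_eq_mul_inv, div_le_one (by positivity)]
        exact pow_le_pow_right₀ (by norm_num) (by omega)
    _ = 9 * Real.exp (2 * y + (-(n + 1) + 2 * κ * l * D * y)) := by
        rw [Real.exp_add, Real.exp_add, two_mul y, Real.exp_add, hy, Real.exp_log hL0]
        ring
    _ ≤ _ := by
        gcongr
        linarith

end RI

open RI MeasureTheory Filter

/-- **Initiation of the renormalization scheme** (Theorem 3.1).
With `u₀(L₀) = κ (log L₀)² L₀^{-(d-2)}` and `Q L₀` any vacant-set law at level `u₀(L₀)`,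
the probability `q₀(u₀(L₀))` of a `*`-path in `{x ∈ ℤ² : Y_x = 0}` from `[-L₀,L₀]² ∩ ℤ²`
to `∂_int([-3L₀,3L₀]^d ∩ ℤ^d)` satisfies `L₀^ρ q₀(u₀(L₀)) → 0` for every `ρ > 0`. -/
theorem q0_decay (d : ℕ) (hd : 3 ≤ d) (κ : ℝ) (hκ : 0 < κ) (ρ : ℝ) (hρ : 0 < ρ)
    (P : Zd d → Measure (ℕ → Zd d)) (hP : IsSRW d P)
    (Q : ℕ → Measure (Zd d → Bool))
    (hQ : ∀ L0 : ℕ, 1 < L0 →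
      IsVacantLaw P (κ * (Real.log L0) ^ 2 * (L0 : ℝ) ^ (-((d : ℝ) - 2))) (Q L0)) :
    Tendsto (fun L0 : ℕ => (L0 : ℝ) ^ ρ * (Q L0 (qEvent d L0)).toReal) atTop (nhds 0) := by
  obtain ⟨B, hB⟩ := hP.eventually_real_qEvent_le hd hκ
  refine squeeze_zero' (Eventually.of_forall fun L => by positivity) ?_
    (tendsto_exp_log_sub_atTop (ρ + B))
  filter_upwards [hB, eventually_gt_atTop 1] with L hL hL1
  have hL0 : (0 : ℝ) < L := by exact_mod_cast (by omega : 0 < L)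
  calc (L : ℝ) ^ ρ * (Q L (qEvent d L)).toReal
      ≤ Real.exp (Real.log L * ρ) *
        (9 * Real.exp (B * Real.log L - Real.log L * Real.sqrt (Real.log L))) := by
        rw [← Real.rpow_def_of_pos hL0]
        exact mul_le_mul_of_nonneg_left (hL (Q L) (hQ L hL1)) (by positivity)
    _ = _ := by
        rw [mul_left_comm, ← Real.exp_add]
        congr 2
        ring
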